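/- arXiv:2303.08679 — 2 statements merged into one kernel-verified Lean document; each statement's English description precedes it below -/
import Mathlib

section
/- Let Ω ⊆ ℝ³ be a bounded open set, τ > 0, θ > 0, v ∈ C_{c,σ}^∞(Ω), and let m ≤ M be real constants. Let ρⁿ : Ω → ℝ be continuous with m ≤ ρⁿ(x) ≤ M for all x ∈ Ω, and let ρ be C² on Ω with ρ and its partial derivatives up to order 2 extending continuously to the closure of Ω, satisfying (ρ − ρⁿ)/τ + v·∇ρ = θ Δρ on Ω and the weak Neumann boundary condition. Then m ≤ ρ(x) ≤ M for all x ∈ Ω. -/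
open MeasureTheory Filter

noncomputable section

abbrev E3 := EuclideanSpace ℝ (Fin 3)

/-- The partial derivative `∂f/∂xᵢ`. -/
noncomputable def pd (i : Fin 3) (f : E3 → ℝ) (x : E3) : ℝ :=
  fderiv ℝ f x (EuclideanSpace.single i 1)

/-- The Laplacian `Δf = ∑ ∂²f/∂xᵢ²`. -/
noncomputable def lap (f : E3 → ℝ) (x : E3) : ℝ :=
  ∑ i : Fin 3, pd i (pd i f) x

/-- `φ ∈ C_c^∞(Ω)`. -/
def TestFun (Ω : Set E3) (φ : E3 → ℝ) : Prop :=
  ContDiff ℝ (⊤ : ℕ∞) φ ∧ HasCompactSupport φ ∧ tsupport φ ⊆ Ω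

/-- `v ∈ C_{c,σ}^∞(Ω)`: smooth compactly supported divergence-free vector fields on `Ω`. -/
def TestVF (Ω : Set E3) (v : Fin 3 → E3 → ℝ) : Prop :=
  (∀ i, TestFun Ω (v i)) ∧ ∀ x ∈ Ω, ∑ i : Fin 3, pd i (v i) x = 0

/-- The weak Neumann boundary condition `∇ρ·ν = 0` on `∂Ω`:
`∫_Ω (Δρ) w = −∫_Ω ∇ρ·∇w` for every bounded locally Lipschitz `w`
with essentially bounded gradient. -/
def WeakNeumann (Ω : Set E3) (ρ : E3 → ℝ) : Prop :=
  ∀ w : E3 → ℝ, LocallyLipschitz w →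
    (∃ C, ∀ x ∈ Ω, |w x| ≤ C) →
    (∃ C, ∀ x ∈ Ω, ‖fderiv ℝ w x‖ ≤ C) →
    (∫ x in Ω, lap ρ x * w x) = -∫ x in Ω, ∑ i : Fin 3, pd i ρ x * pd i w x

/-- `ρ` is C² on `Ω` with `ρ` and its partial derivatives up to order 2
extending continuously to the closure of `Ω`. -/
def C2ext (Ω : Set E3) (ρ : E3 → ℝ) : Prop :=
  ContDiffOn ℝ 2 ρ Ω ∧ ContinuousOn ρ (closure Ω) ∧
  (∀ i, ContinuousOn (pd i ρ) (closure Ω)) ∧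
  (∀ i j, ContinuousOn (pd i (pd j ρ)) (closure Ω))

/-- `ρ` is C¹ on `Ω` with `ρ` and its first partial derivatives
extending continuously to the closure of `Ω`. -/
def C1ext (Ω : Set E3) (ρ : E3 → ℝ) : Prop :=
  ContDiffOn ℝ 1 ρ Ω ∧ ContinuousOn ρ (closure Ω) ∧
  (∀ i, ContinuousOn (pd i ρ) (closure Ω))


/-- Bounded globally Lipschitz functions. -/
def Lip (φ : E3 → ℝ) : Prop :=
  ∃ K : ℝ, 0 ≤ K ∧ (∀ x y, |φ x - φ y| ≤ K * ‖x - y‖) ∧ ∀ x, |φ x| ≤ K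

lemma Lip.mul {f g : E3 → ℝ} (hf : Lip f) (hg : Lip g) : Lip (fun x => f x * g x) := by
  obtain ⟨K, hK, h1, h2⟩ := hf
  obtain ⟨K', hK', h1', h2'⟩ := hg
  refine ⟨2 * K * K' + K * K', by positivity, fun x y => ?_, fun x => ?_⟩
  · have : f x * g x - f y * g y = f x * (g x - g y) + (f x - f y) * g y := by ring
    rw [this]
    refine (abs_add_le _ _).trans ?_
    rw [abs_mul, abs_mul]
    have a1 := mul_le_mul (h2 x) (h1' x y) (abs_nonneg _) hK
    have a2 := mul_le_mul (h1 x y) (h2' y) (abs_nonneg _) (by positivity)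
    have : 0 ≤ K * K' * ‖x - y‖ := by positivity
    nlinarith
  · rw [abs_mul]
    have := mul_le_mul (h2 x) (h2' x) (abs_nonneg _) hK
    nlinarith [mul_nonneg hK hK']

lemma Lip.add {f g : E3 → ℝ} (hf : Lip f) (hg : Lip g) : Lip (fun x => f x + g x) := by
  obtain ⟨K, hK, h1, h2⟩ := hf
  obtain ⟨K', hK', h1', h2'⟩ := hg
  refine ⟨K + K', by positivity, fun x y => ?_, fun x => ?_⟩
  · have : f x + g x - (f y + g y) = (f x - f y) + (g x - g y) := by ring
    rw [this]
    refine (abs_add_le _ _).trans ?_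
    linarith [h1 x y, h1' x y]
  · exact (abs_add_le _ _).trans (by linarith [h2 x, h2' x])

lemma Lip.const (c : ℝ) : Lip (fun _ => c) :=
  ⟨|c|, abs_nonneg _, fun x y => by simp; positivity, fun _ => le_rfl⟩

lemma Lip.sub {f g : E3 → ℝ} (hf : Lip f) (hg : Lip g) : Lip (fun x => f x - g x) := by
  have := hf.add ((Lip.const (-1)).mul hg)
  have e : (fun x => f x + -1 * g x) = fun x => f x - g x := by
    funext x
    ring
  rwa [e] at this

lemma Lip.lipschitzWith {f : E3 → ℝ} {K : ℝ} (hK : 0 ≤ K)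
    (h : ∀ x y, |f x - f y| ≤ K * ‖x - y‖) : LipschitzWith ⟨K, hK⟩ f := by
  refine LipschitzWith.of_dist_le_mul fun x y => ?_
  rw [dist_eq_norm, dist_eq_norm]
  exact h x y

/-- Functions for which the weak formulation makes sense. -/
def Adm (Ω : Set E3) (h : E3 → ℝ) : Prop :=
  ContinuousOn h Ω ∧ ∃ B : ℝ, 0 ≤ B ∧ (∀ x ∈ Ω, |h x| ≤ B) ∧
    ∀ᵐ x ∂(volume.restrict Ω), DifferentiableAt ℝ h x ∧ ‖fderiv ℝ h x‖ ≤ B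

lemma Lip.fderiv_le {f : E3 → ℝ} {K : ℝ} (hK : 0 ≤ K)
    (h : ∀ x y, |f x - f y| ≤ K * ‖x - y‖) (x : E3) : ‖fderiv ℝ f x‖ ≤ K :=
  norm_fderiv_le_of_lip' ℝ hK (Eventually.of_forall fun y => h y x)

lemma Lip.ae_diff {f : E3 → ℝ} (hf : Lip f) : ∀ᵐ x, DifferentiableAt ℝ f x := by
  obtain ⟨K, hK, h1, h2⟩ := hf
  exact (Lip.lipschitzWith hK h1).ae_differentiableAt

lemma Lip.continuous {f : E3 → ℝ} (hf : Lip f) : Continuous f := by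
  obtain ⟨K, hK, h1, h2⟩ := hf
  exact (Lip.lipschitzWith hK h1).continuous

lemma Lip.adm {f : E3 → ℝ} (hf : Lip f) (Ω : Set E3) : Adm Ω f := by
  have hd := hf.ae_diff
  refine ⟨hf.continuous.continuousOn, ?_⟩
  obtain ⟨K, hK, h1, h2⟩ := hf
  refine ⟨K, hK, fun x _ => h2 x, ae_restrict_of_ae ?_⟩
  filter_upwards [hd] with x hx
  exact ⟨hx, Lip.fderiv_le hK h1 x⟩

lemma Adm.sub {Ω : Set E3} {f g : E3 → ℝ} (hf : Adm Ω f) (hg : Adm Ω g) :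
    Adm Ω (fun x => f x - g x) := by
  obtain ⟨hc, B, hB, h1, h2⟩ := hf
  obtain ⟨hc', B', hB', h1', h2'⟩ := hg
  refine ⟨hc.sub hc', B + B', by positivity, fun x hx => ?_, ?_⟩
  · exact (abs_sub _ _).trans (by linarith [h1 x hx, h1' x hx])
  · filter_upwards [h2, h2'] with x hx hx'
    refine ⟨hx.1.sub hx'.1, ?_⟩
    rw [fderiv_fun_sub hx.1 hx'.1]
    exact (norm_sub_le _ _).trans (by linarith [hx.2, hx'.2])

lemma fderiv_mul_le {f g : E3 → ℝ} {x : E3} (hf : DifferentiableAt ℝ f x)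
    (hg : DifferentiableAt ℝ g x) :
    ‖fderiv ℝ (fun x => f x * g x) x‖ ≤ |f x| * ‖fderiv ℝ g x‖ + |g x| * ‖fderiv ℝ f x‖ := by
  rw [fderiv_fun_mul hf hg]
  refine (norm_add_le _ _).trans ?_
  rw [norm_smul, norm_smul]
  simp

lemma Adm.mul {Ω : Set E3} (hΩ : IsOpen Ω) {f g : E3 → ℝ} (hf : Adm Ω f) (hg : Adm Ω g) :
    Adm Ω (fun x => f x * g x) := by
  obtain ⟨hc, B, hB, h1, h2⟩ := hf
  obtain ⟨hc', B', hB', h1', h2'⟩ := hg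
  refine ⟨hc.mul hc', 2 * (B * B'), by positivity, fun x hx => ?_, ?_⟩
  · rw [abs_mul]
    have := mul_le_mul (h1 x hx) (h1' x hx) (abs_nonneg _) hB
    nlinarith [mul_nonneg hB hB']
  · filter_upwards [h2, h2', ae_restrict_mem hΩ.measurableSet] with x hx hx' hm
    refine ⟨hx.1.mul hx'.1, (fderiv_mul_le hx.1 hx'.1).trans ?_⟩
    have := mul_le_mul (h1 x hm) hx'.2 (norm_nonneg _) hB
    have := mul_le_mul (h1' x hm) hx.2 (norm_nonneg _) hB'
    linarith

/-- The weak form functional. -/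
def LL (Ω : Set E3) (ρ w : E3 → ℝ) : ℝ :=
  ∫ x in Ω, (lap ρ x * w x + ∑ i : Fin 3, pd i ρ x * pd i w x)

lemma pd_le (i : Fin 3) (f : E3 → ℝ) (x : E3) : |pd i f x| ≤ ‖fderiv ℝ f x‖ := by
  have := (fderiv ℝ f x).le_opNorm (EuclideanSpace.single i 1)
  simpa [pd] using this

lemma pd_meas (i : Fin 3) (f : E3 → ℝ) : Measurable (pd i f) :=
  measurable_fderiv_apply_const ℝ f _

/-- Bounds on rho. -/
def RB (Ω : Set E3) (ρ : E3 → ℝ) (B : ℝ) : Prop :=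
  0 ≤ B ∧ (∀ x ∈ closure Ω, |ρ x| ≤ B) ∧ (∀ x ∈ closure Ω, ∀ i, |pd i ρ x| ≤ B) ∧
    (∀ x ∈ closure Ω, |lap ρ x| ≤ B)

lemma lap_cont {Ω : Set E3} {ρ : E3 → ℝ} (hρ : C2ext Ω ρ) : ContinuousOn (lap ρ) (closure Ω) := by
  unfold lap
  exact continuousOn_finsetSum _ fun i _ => hρ.2.2.2 i i

lemma exists_RB {Ω : Set E3} (hb : Bornology.IsBounded Ω) {ρ : E3 → ℝ} (hρ : C2ext Ω ρ) :
    ∃ B, RB Ω ρ B := by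
  have hc : IsCompact (closure Ω) := hb.isCompact_closure
  obtain ⟨B1, h1⟩ := hc.exists_bound_of_continuousOn hρ.2.1
  obtain ⟨B2, h2⟩ := hc.exists_bound_of_continuousOn (lap_cont hρ)
  choose B3 h3 using fun i => hc.exists_bound_of_continuousOn (hρ.2.2.1 i)
  have hs : ∀ i, |B3 i| ≤ ∑ j, |B3 j| := fun i =>
    Finset.single_le_sum (f := fun j => |B3 j|) (fun j _ => abs_nonneg _) (Finset.mem_univ i)
  have h0 : 0 ≤ ∑ j, |B3 j| := Finset.sum_nonneg fun j _ => abs_nonneg _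
  refine ⟨|B1| + |B2| + ∑ i, |B3 i|, by positivity, fun x hx => ?_, fun x hx i => ?_, fun x hx => ?_⟩
  · have := h1 x hx
    rw [Real.norm_eq_abs] at this
    linarith [le_abs_self B1, abs_nonneg B2]
  · have := h3 i x hx
    rw [Real.norm_eq_abs] at this
    linarith [abs_nonneg B1, abs_nonneg B2, hs i, le_abs_self (B3 i)]
  · have := h2 x hx
    rw [Real.norm_eq_abs] at this
    linarith [le_abs_self B2, abs_nonneg B1]

lemma sum_pd_le (ρ w : E3 → ℝ) (x : E3) (A : ℝ) (hA : ∀ i, |pd i ρ x| ≤ A) :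
    |∑ i : Fin 3, pd i ρ x * pd i w x| ≤ 3 * (A * ‖fderiv ℝ w x‖) := by
  refine (Finset.abs_sum_le_sum_abs _ _).trans ?_
  have : ∀ i ∈ (Finset.univ : Finset (Fin 3)), |pd i ρ x * pd i w x| ≤ A * ‖fderiv ℝ w x‖ := by
    intro i _
    rw [abs_mul]
    exact mul_le_mul (hA i) (pd_le i w x) (abs_nonneg _) ((abs_nonneg _).trans (hA i))
  refine (Finset.sum_le_sum this).trans ?_
  simp

lemma LL_int {Ω : Set E3} (hΩ : IsOpen Ω) (hb : Bornology.IsBounded Ω) {ρ w : E3 → ℝ}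
    (hρ : C2ext Ω ρ) (hw : Adm Ω w) :
    IntegrableOn (fun x => lap ρ x * w x) Ω ∧
    IntegrableOn (fun x => ∑ i : Fin 3, pd i ρ x * pd i w x) Ω := by
  obtain ⟨B, hB0, hB1, hB2, hB3⟩ := exists_RB hb hρ
  obtain ⟨hc, C, hC, h1, h2⟩ := hw
  have hfin : volume Ω ≠ ⊤ := hb.measure_lt_top.ne
  constructor
  · have : IsFiniteMeasure (volume.restrict Ω) := ⟨by simpa using hfin.lt_top⟩
    refine Integrable.of_bound (C := B * C) ?_ ?_
    · exact (((lap_cont hρ).mono subset_closure).mul hc).aestronglyMeasurable hΩ.measurableSet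
    · filter_upwards [ae_restrict_mem hΩ.measurableSet] with x hx
      rw [Real.norm_eq_abs, abs_mul]
      exact mul_le_mul (hB3 x (subset_closure hx)) (h1 x hx) (abs_nonneg _) hB0
  · have : IsFiniteMeasure (volume.restrict Ω) := ⟨by simpa using hfin.lt_top⟩
    refine Integrable.of_bound (C := 3 * (B * C)) ?_ ?_
    · exact (Finset.measurable_sum _ fun i _ => (pd_meas i ρ).mul (pd_meas i w)).aestronglyMeasurable
    · filter_upwards [ae_restrict_mem hΩ.measurableSet, h2] with x hx hx2
      rw [Real.norm_eq_abs]
      refine (sum_pd_le ρ w x B (hB2 x (subset_closure hx))).trans ?_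
      have := mul_le_mul_of_nonneg_left hx2.2 hB0
      linarith

lemma LL_sub {Ω : Set E3} (hΩ : IsOpen Ω) (hb : Bornology.IsBounded Ω) {ρ f g : E3 → ℝ}
    (hρ : C2ext Ω ρ) (hf : Adm Ω f) (hg : Adm Ω g) :
    LL Ω ρ (fun x => f x - g x) = LL Ω ρ f - LL Ω ρ g := by
  unfold LL
  have a := LL_int hΩ hb hρ hf
  have b := LL_int hΩ hb hρ hg
  refine Eq.trans ?_ (integral_sub (a.1.add a.2) (b.1.add b.2))
  refine integral_congr_ae ?_
  filter_upwards [hf.2.choose_spec.2.2, hg.2.choose_spec.2.2] with x hx hx'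
  simp only [pd, fderiv_fun_sub hx.1 hx'.1, sub_apply, mul_sub,
    Finset.sum_sub_distrib]
  ring

lemma LL_congr {Ω : Set E3} (hΩ : IsOpen Ω) {ρ f g : E3 → ℝ} (h : ∀ x ∈ Ω, f x = g x) :
    LL Ω ρ f = LL Ω ρ g := by
  unfold LL
  refine setIntegral_congr_fun hΩ.measurableSet fun x hx => ?_
  have he : f =ᶠ[nhds x] g := by
    filter_upwards [hΩ.mem_nhds hx] with y hy using h y hy
  simp only [pd, he.fderiv_eq, h x hx]

lemma LL_lip {Ω : Set E3} (hΩ : IsOpen Ω) (hb : Bornology.IsBounded Ω) {ρ f : E3 → ℝ}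
    (hρ : C2ext Ω ρ) (hN : WeakNeumann Ω ρ) (hf : Lip f) : LL Ω ρ f = 0 := by
  have a := LL_int hΩ hb hρ (hf.adm Ω)
  unfold LL
  rw [integral_add a.1 a.2]
  obtain ⟨K, hK, h1, h2⟩ := hf
  rw [hN f (Lip.lipschitzWith hK h1).locallyLipschitz ⟨K, fun x _ => h2 x⟩
    ⟨K, fun x _ => Lip.fderiv_le hK h1 x⟩]
  ring

/-- Distance cutoff. -/
def cut (δ : ℝ) (S : Set E3) (x : E3) : ℝ := max 0 (min 1 (2 - Metric.infDist x S / δ))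

lemma cut_nonneg (δ : ℝ) (S : Set E3) (x : E3) : 0 ≤ cut δ S x := le_max_left _ _

lemma cut_le_one (δ : ℝ) (S : Set E3) (x : E3) : cut δ S x ≤ 1 :=
  max_le zero_le_one (min_le_left _ _)

lemma cut_eq_one {δ : ℝ} (hδ : 0 < δ) {S : Set E3} {x : E3} (h : Metric.infDist x S ≤ δ) :
    cut δ S x = 1 := by
  have : Metric.infDist x S / δ ≤ 1 := (div_le_one hδ).2 h
  unfold cut
  rw [min_eq_left (by linarith), max_eq_right zero_le_one]

lemma cut_eq_zero {δ : ℝ} (hδ : 0 < δ) {S : Set E3} {x : E3} (h : 2 * δ ≤ Metric.infDist x S) :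
    cut δ S x = 0 := by
  have : 2 ≤ Metric.infDist x S / δ := (le_div_iff₀ hδ).2 h
  unfold cut
  exact max_eq_left ((min_le_right _ _).trans (by linarith))

lemma cut_lip' {δ : ℝ} (hδ : 0 < δ) (S : Set E3) (x y : E3) :
    |cut δ S x - cut δ S y| ≤ (1 / δ) * ‖x - y‖ := by
  have h1 : |Metric.infDist x S - Metric.infDist y S| ≤ ‖x - y‖ := by
    have := (Metric.lipschitz_infDist_pt S).dist_le_mul x y
    simpa [Real.dist_eq, dist_eq_norm] using this
  unfold cut
  refine (abs_max_sub_max_le_max _ _ _ _).trans ?_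
  refine (max_le_max le_rfl (abs_min_sub_min_le_max _ _ _ _)).trans ?_
  have h2 : |2 - Metric.infDist x S / δ - (2 - Metric.infDist y S / δ)| ≤ (1 / δ) * ‖x - y‖ := by
    have : 2 - Metric.infDist x S / δ - (2 - Metric.infDist y S / δ)
        = (1 / δ) * (-(Metric.infDist x S - Metric.infDist y S)) := by ring
    rw [this, abs_mul, abs_neg, abs_of_pos (by positivity : 0 < 1 / δ)]
    gcongr
  have h3 : 0 ≤ (1 / δ) * ‖x - y‖ := by positivity
  simp only [sub_self, abs_zero]
  exact max_le h3 (max_le h3 h2)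

lemma cut_lip {δ : ℝ} (hδ : 0 < δ) (S : Set E3) : Lip (cut δ S) := by
  have h0 : 0 < 1 / δ := by positivity
  refine ⟨1 / δ + 1, by positivity, fun x y => ?_, fun x => ?_⟩
  · refine (cut_lip' hδ S x y).trans ?_
    gcongr
    linarith
  · rw [abs_of_nonneg (cut_nonneg _ _ _)]
    linarith [cut_le_one δ S x]

/-- Good points: integration by parts holds locally. -/
def GoodPt (Ω : Set E3) (ρ u : E3 → ℝ) (p : E3) : Prop :=
  ∃ r > 0, ∀ φ : E3 → ℝ, Lip φ → (∀ x, x ∉ Metric.ball p r → φ x = 0) →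
    LL Ω ρ (fun x => u x * φ x) = 0

lemma good_compact {Ω : Set E3} (hΩ : IsOpen Ω) (hb : Bornology.IsBounded Ω) {ρ u : E3 → ℝ}
    (hρ : C2ext Ω ρ) (hu : Adm Ω u) {K : Set E3} (hK : IsCompact K)
    (hg : ∀ p ∈ K, GoodPt Ω ρ u p) (φ : E3 → ℝ) (hφ : Lip φ) (h0 : ∀ x ∈ Ω, x ∉ K → φ x = 0) :
    LL Ω ρ (fun x => u x * φ x) = 0 := by
  have key : ∃ η : E3 → ℝ, Lip η ∧ (∀ x ∈ K, η x = 1) ∧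
      ∀ φ : E3 → ℝ, Lip φ → LL Ω ρ (fun x => u x * (φ x * η x)) = 0 := by
    refine hK.induction_on (p := fun s => ∃ η : E3 → ℝ, Lip η ∧ (∀ x ∈ s, η x = 1) ∧
      ∀ φ : E3 → ℝ, Lip φ → LL Ω ρ (fun x => u x * (φ x * η x)) = 0) ?_ ?_ ?_ ?_
    · refine ⟨fun _ => 0, Lip.const 0, by simp, fun φ _ => ?_⟩
      simp [LL, pd]
    · rintro s t hst ⟨η, h1, h2, h3⟩
      exact ⟨η, h1, fun x hx => h2 x (hst hx), h3⟩
    · rintro s t ⟨η, h1, h2, h3⟩ ⟨η', h1', h2', h3'⟩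
      refine ⟨fun x => η x - (η x * η' x - η' x), h1.sub ((h1.mul h1').sub h1'), ?_, ?_⟩
      · rintro x (hx | hx)
        · simp only [h2 x hx]; ring
        · simp only [h2' x hx]; ring
      · intro φ hφ
        have e1 := h3 φ hφ
        have e2 := h3' (fun x => φ x * η x) (hφ.mul h1)
        have e3 := h3' φ hφ
        have a1 := hu.mul hΩ ((hφ.mul h1).adm Ω)
        have a2 := hu.mul hΩ (((hφ.mul h1).mul h1').adm Ω)
        have a3 := hu.mul hΩ ((hφ.mul h1').adm Ω)
        have s1 := LL_sub hΩ hb hρ a2 a3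
        have s2 := LL_sub hΩ hb hρ a1 (a2.sub a3)
        rw [s1, e1, e2, e3] at s2
        rw [sub_self, sub_self] at s2
        rw [← s2]
        congr 1
        funext x
        ring
    · intro p hp
      obtain ⟨r, hr, h⟩ := hg p hp
      refine ⟨Metric.ball p (r / 2), mem_nhdsWithin_of_mem_nhds (Metric.ball_mem_nhds _ (by positivity)),
        cut (r / 2) {p}, cut_lip (by positivity) _, fun x hx => ?_, fun φ hφ => ?_⟩
      · refine cut_eq_one (by positivity) ?_
        rw [Metric.infDist_singleton]
        exact (Metric.mem_ball.1 hx).le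
      · refine h _ (hφ.mul (cut_lip (by positivity) _)) fun x hx => ?_
        rw [cut_eq_zero (by positivity), mul_zero]
        rw [Metric.infDist_singleton]
        rw [Metric.mem_ball, not_lt] at hx
        linarith
  obtain ⟨η, h1, h2, h3⟩ := key
  rw [← h3 φ hφ]
  refine LL_congr hΩ fun x hx => ?_
  by_cases hxK : x ∈ K
  · rw [h2 x hxK, mul_one]
  · rw [h0 x hx hxK, zero_mul]

lemma est {Ω : Set E3} (hΩ : IsOpen Ω) (hb : Bornology.IsBounded Ω) {ρ h φ : E3 → ℝ}
    (hρ : C2ext Ω ρ) (hh : Adm Ω h) (hφ : Lip φ) :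
    ∃ C : ℝ, 0 ≤ C ∧ ∀ (S : Set E3) (δ m : ℝ), 0 < δ → 0 ≤ m →
      (∀ x ∈ Ω, Metric.infDist x S ≤ 2 * δ → ∀ i, |pd i ρ x| * |h x| ≤ m) →
      |LL Ω ρ (fun x => h x * (φ x * cut δ S x))| ≤
        (C + C * (m / δ)) * volume.real (Ω ∩ {x | Metric.infDist x S ≤ 2 * δ}) := by
  obtain ⟨B, hB0, hB1, hB2, hB3⟩ := exists_RB hb hρ
  obtain ⟨hcA, A, hA, hA1, hA2⟩ := hh.mul hΩ (hφ.adm Ω)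
  obtain ⟨K, hK, hK1, hK2⟩ := hφ
  refine ⟨4 * (B * A) + 3 * K, by positivity, fun S δ m hδ hm hS => ?_⟩
  have hmeas : MeasurableSet (Ω ∩ {x | Metric.infDist x S ≤ 2 * δ}) :=
    hΩ.measurableSet.inter
      (isClosed_le (Metric.continuous_infDist_pt S) continuous_const).measurableSet
  unfold LL
  rw [setIntegral_eq_of_subset_of_forall_sdiff_eq_zero hΩ.measurableSet
    (s := Ω ∩ {x | Metric.infDist x S ≤ 2 * δ}) Set.inter_subset_left]
  · rw [← Real.norm_eq_abs]
    refine norm_setIntegral_le_of_norm_le_const_ae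
      ((measure_mono Set.inter_subset_left).trans_lt hb.measure_lt_top) ?_
    have hae := ae_restrict_of_ae_restrict_of_subset
      (s := Ω ∩ {x | Metric.infDist x S ≤ 2 * δ}) Set.inter_subset_left hA2
    have hcd := ae_restrict_of_ae (s := Ω ∩ {x | Metric.infDist x S ≤ 2 * δ})
      (cut_lip hδ S).ae_diff
    filter_upwards [hae, hcd, ae_restrict_mem hmeas] with x h1 h2 hx
    have hxc : x ∈ closure Ω := subset_closure hx.1
    have hfun : (fun x => h x * (φ x * cut δ S x)) = fun x => (h x * φ x) * cut δ S x := by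
      funext y; ring
    have hc1 : |cut δ S x| ≤ 1 := by
      rw [abs_of_nonneg (cut_nonneg _ _ _)]; exact cut_le_one _ _ _
    have hfd : ‖fderiv ℝ (fun x => h x * (φ x * cut δ S x)) x‖ ≤ |h x| * K * (1 / δ) + A := by
      rw [hfun]
      refine (fderiv_mul_le h1.1 h2).trans ?_
      have b1 : ‖fderiv ℝ (cut δ S) x‖ ≤ 1 / δ :=
        Lip.fderiv_le (by positivity) (cut_lip' hδ S) x
      have b2 : |h x * φ x| ≤ |h x| * K := by
        rw [abs_mul]; exact mul_le_mul_of_nonneg_left (hK2 x) (abs_nonneg _)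
      have b3 := mul_le_mul b2 b1 (norm_nonneg _) (by positivity)
      have b4 := mul_le_mul hc1 h1.2 (norm_nonneg _) zero_le_one
      linarith
    have hterm : ∀ i ∈ (Finset.univ : Finset (Fin 3)),
        |pd i ρ x * pd i (fun x => h x * (φ x * cut δ S x)) x| ≤ K * (m / δ) + B * A := by
      intro i _
      rw [abs_mul]
      have c1 := mul_le_mul_of_nonneg_left ((pd_le i _ x).trans hfd) (abs_nonneg (pd i ρ x))
      have c2 := hS x hx.1 hx.2 i
      have c3 := mul_le_mul_of_nonneg_right c2 (by positivity : 0 ≤ K * (1 / δ))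
      have c4 := mul_le_mul_of_nonneg_right (hB2 x hxc i) hA
      have c5 : m * (K * (1 / δ)) = K * (m / δ) := by ring
      have c6 : |pd i ρ x| * (|h x| * K * (1 / δ) + A)
        = |pd i ρ x| * |h x| * (K * (1 / δ)) + |pd i ρ x| * A := by ring
      linarith
    rw [Real.norm_eq_abs]
    refine (abs_add_le _ _).trans ?_
    have d1 : |lap ρ x * (h x * (φ x * cut δ S x))| ≤ B * A := by
      have : h x * (φ x * cut δ S x) = (h x * φ x) * cut δ S x := by ring
      rw [this, abs_mul, abs_mul]
      have e1 := mul_le_mul (hA1 x hx.1) hc1 (abs_nonneg _) hA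
      rw [mul_one] at e1
      exact mul_le_mul (hB3 x hxc) e1 (by positivity) hB0
    have d2 := (Finset.abs_sum_le_sum_abs _ _).trans (Finset.sum_le_sum hterm)
    simp only [Finset.sum_const, Finset.card_univ, Fintype.card_fin, nsmul_eq_mul] at d2
    have d3 : 0 ≤ 4 * (B * A) * (m / δ) := by positivity
    push_cast at d2
    have d4 : 0 ≤ K := hK
    nlinarith
  · rintro x ⟨hx, hx'⟩
    have hx2 : 2 * δ < Metric.infDist x S := by
      by_contra hcon
      exact hx' ⟨hx, not_lt.1 hcon⟩
    have hz : (fun x => h x * (φ x * cut δ S x)) =ᶠ[nhds x] fun _ => 0 := by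
      filter_upwards [(Metric.continuous_infDist_pt S).continuousAt.eventually (lt_mem_nhds hx2)]
        with y hy
      rw [cut_eq_zero hδ hy.le]; ring
    have hz0 := hz.self_of_nhds
    simp only at hz0
    simp only [hz0, pd, hz.fderiv_eq]
    simp

lemma small_nbhd {Ω : Set E3} (hΩ : IsOpen Ω) (hb : Bornology.IsBounded Ω) {S : Set E3}
    (hS : IsClosed S) (hne : S.Nonempty) (hd : ∀ x ∈ S, x ∉ Ω) {ε : ℝ} (hε : 0 < ε) :
    ∃ δ₀ > 0, ∀ δ ≤ δ₀, volume.real (Ω ∩ {x | Metric.infDist x S ≤ 2 * δ}) ≤ ε := by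
  let T : ℕ → Set E3 := fun n => Ω ∩ {x | Metric.infDist x S ≤ 2 * (1 / ((n : ℝ) + 1))}
  have hfin : ∀ s : Set E3, s ⊆ Ω → volume s ≠ ⊤ := fun s hs =>
    ((measure_mono hs).trans_lt hb.measure_lt_top).ne
  have hTm : ∀ n, MeasurableSet (T n) := fun n => hΩ.measurableSet.inter
      (isClosed_le (Metric.continuous_infDist_pt S) continuous_const).measurableSet
  have hanti : Antitone T := by
    intro a b hab x hx
    refine ⟨hx.1, le_trans (show Metric.infDist x S ≤ _ from hx.2) ?_⟩
    have : (1 : ℝ) / ((b : ℝ) + 1) ≤ 1 / ((a : ℝ) + 1) := Nat.one_div_le_one_div hab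
    linarith
  have hlim := tendsto_measure_iInter_atTop (μ := volume) (s := T)
    (fun n => (hTm n).nullMeasurableSet) hanti ⟨0, hfin _ Set.inter_subset_left⟩
  have hempty : ⋂ n, T n = ∅ := by
    ext x
    simp only [Set.mem_iInter, Set.mem_empty_iff_false, iff_false, not_forall]
    by_contra hcon
    push Not at hcon
    have hx : x ∈ Ω := (hcon 0).1
    have hle : Metric.infDist x S ≤ 0 := by
      have t1 : Tendsto (fun n : ℕ => 2 * (1 / ((n : ℝ) + 1))) atTop (nhds (2 * 0)) :=
        (tendsto_one_div_add_atTop_nhds_zero_nat (𝕜 := ℝ)).const_mul 2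
      rw [mul_zero] at t1
      exact ge_of_tendsto' t1 fun n => (hcon n).2
    have : x ∈ S := (hS.mem_iff_infDist_zero hne).2 (le_antisymm hle Metric.infDist_nonneg)
    exact hd x this hx
  rw [hempty, measure_empty] at hlim
  have hev := hlim.eventually (gt_mem_nhds (ENNReal.ofReal_pos.2 hε))
  obtain ⟨n, hn⟩ := hev.exists
  refine ⟨1 / ((n : ℝ) + 1), by positivity, fun δ hδ => ?_⟩
  have hsub : Ω ∩ {x | Metric.infDist x S ≤ 2 * δ} ⊆ T n := fun x hx =>
    ⟨hx.1, le_trans (show Metric.infDist x S ≤ _ from hx.2) (by linarith)⟩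
  have := (measure_mono hsub).trans hn.le
  exact ENNReal.toReal_le_of_le_ofReal hε.le this

lemma cone_nbhd {Ω : Set E3} (hΩ : IsOpen Ω) (hb : Bornology.IsBounded Ω) {S : Set E3}
    (hS : IsClosed S) (hne : S.Nonempty) (i : Fin 3) {k : ℝ} (hk : 1 ≤ k)
    (hcone : ∀ p ∈ S, ∀ q ∈ S, ∀ s : ℝ, 0 < s → s ≤ 1 / k →
      ¬ ‖q - p - s • (EuclideanSpace.single i (1 : ℝ) : E3)‖ < s / k) :
    ∃ C : ℝ, 0 ≤ C ∧ ∀ n : ℕ, 0 < n →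
      volume.real (Ω ∩ {x | Metric.infDist x S ≤ 2 * (1 / (5 * k ^ 2 * n))}) ≤
        C * (1 / (5 * k ^ 2 * n)) := by
  obtain ⟨R, hR⟩ := hb.subset_closedBall (0 : E3)
  have hk0 : 0 < k := by linarith
  have hVfin : volume (Metric.closedBall (0 : E3) (R + 1)) ≠ ⊤ := Metric.isBounded_closedBall.measure_lt_top.ne
  refine ⟨5 * k ^ 2 * volume.real (Metric.closedBall (0 : E3) (R + 1)), by positivity, fun n hn => ?_⟩
  have hn' : (0 : ℝ) < n := by exact_mod_cast hn
  set e : E3 := EuclideanSpace.single i (1 : ℝ) with he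
  have hen : ‖e‖ = 1 := by simp [he]
  set δ : ℝ := 1 / (5 * k ^ 2 * n) with hδ
  have hδ0 : 0 < δ := by positivity
  set T : Set E3 := Ω ∩ {x | Metric.infDist x S ≤ 2 * δ} with hT
  set s0 : ℝ := 1 / (k * n) with hs0
  have hs00 : 0 < s0 := by positivity
  have hs0δ : s0 / k = 5 * δ := by rw [hs0, hδ]; field_simp
  have hTm : MeasurableSet T := hΩ.measurableSet.inter
      (isClosed_le (Metric.continuous_infDist_pt S) continuous_const).measurableSet
  let P : ℕ → Set E3 := fun j => (fun x => x + (-((j : ℝ) * s0)) • e) ⁻¹' T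
  have hPm : ∀ j, MeasurableSet (P j) := fun j => (measurable_add_const _) hTm
  have hPv : ∀ j, volume (P j) = volume T := fun j => measure_preimage_add_right volume _ _
  have hlt : ∀ a b : ℕ, a < b → b < n → Disjoint (P a) (P b) := by
    intro a b hab hbn
    rw [Set.disjoint_left]
    intro x hxa hxb
    obtain ⟨p, hp, hpd⟩ := hS.exists_infDist_eq_dist hne (x + (-((a : ℝ) * s0)) • e)
    obtain ⟨q, hq, hqd⟩ := hS.exists_infDist_eq_dist hne (x + (-((b : ℝ) * s0)) • e)
    have h1 : Metric.infDist (x + (-((a : ℝ) * s0)) • e) S ≤ 2 * δ := hxa.2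
    have h2 : Metric.infDist (x + (-((b : ℝ) * s0)) • e) S ≤ 2 * δ := hxb.2
    rw [hpd, dist_eq_norm] at h1
    rw [hqd, dist_eq_norm] at h2
    have hab' : (a : ℝ) + 1 ≤ b := by exact_mod_cast hab
    have hbn' : (b : ℝ) ≤ n := by exact_mod_cast hbn.le
    have ha0 : (0 : ℝ) ≤ a := by positivity
    have hsle : ((b : ℝ) - a) * s0 ≤ 1 / k := by
      have : 1 / k = n * s0 := by rw [hs0]; field_simp
      rw [this]
      exact mul_le_mul_of_nonneg_right (by linarith) hs00.le
    have hs1 : s0 ≤ ((b : ℝ) - a) * s0 := by nlinarith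
    refine hcone q hq p hp (((b : ℝ) - a) * s0) (by linarith) hsle ?_
    have hid : p - q - (((b : ℝ) - a) * s0) • e =
        (x + (-((b : ℝ) * s0)) • e - q) - (x + (-((a : ℝ) * s0)) • e - p) := by
      module
    rw [hid]
    refine (norm_sub_le _ _).trans_lt ?_
    have : s0 / k ≤ ((b : ℝ) - a) * s0 / k := by gcongr
    linarith
  have hdis : (↑(Finset.range n) : Set ℕ).PairwiseDisjoint P := by
    intro a ha b hb' hab
    have ha' : a < n := by simpa using ha
    have hb'' : b < n := by simpa using hb'
    rcases lt_or_gt_of_ne hab with h | h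
    · exact hlt a b h hb''
    · exact (hlt b a h ha').symm
  have hU := measure_biUnion_finset (μ := volume) hdis (fun j _ => hPm j)
  simp only [hPv, Finset.sum_const, Finset.card_range, nsmul_eq_mul] at hU
  have hsub : (⋃ j ∈ Finset.range n, P j) ⊆ Metric.closedBall (0 : E3) (R + 1) := by
    intro x hx
    simp only [Set.mem_iUnion, Finset.mem_range] at hx
    obtain ⟨j, hj, hxj⟩ := hx
    have h1 := hR hxj.1
    rw [mem_closedBall_zero_iff] at h1 ⊢
    have hx' : x = (x + (-((j : ℝ) * s0)) • e) + ((j : ℝ) * s0) • e := by module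
    rw [hx']
    refine (norm_add_le _ _).trans (add_le_add h1 ?_)
    rw [norm_smul, hen, mul_one, Real.norm_eq_abs, abs_of_nonneg (by positivity)]
    have hj' : (j : ℝ) ≤ n := by exact_mod_cast hj.le
    calc (j : ℝ) * s0 ≤ n * s0 := by gcongr
      _ = 1 / k := by rw [hs0]; field_simp
      _ ≤ 1 := by rw [div_le_one hk0]; exact hk
  have hle := measure_mono (μ := volume) hsub
  rw [hU] at hle
  have hle' := ENNReal.toReal_mono hVfin hle
  rw [ENNReal.toReal_mul, ENNReal.toReal_natCast] at hle'
  change (n : ℝ) * volume.real T ≤ volume.real (Metric.closedBall (0 : E3) (R + 1)) at hle'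
  have : 5 * k ^ 2 * volume.real (Metric.closedBall (0 : E3) (R + 1)) * δ
      = volume.real (Metric.closedBall (0 : E3) (R + 1)) / n := by
    rw [hδ]; field_simp
  rw [this, le_div_iff₀ hn']
  linarith

lemma lip_extend {S : Set E3} {u : E3 → ℝ} {k B : ℝ} (hk : 0 ≤ k) (hB : 0 ≤ B)
    (h1 : ∀ x ∈ S, ∀ y ∈ S, |u x - u y| ≤ k * ‖x - y‖) (h2 : ∀ x ∈ S, |u x| ≤ B) :
    ∃ w : E3 → ℝ, Lip w ∧ ∀ x ∈ S, w x = u x := by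
  have hl : LipschitzOnWith ⟨k, hk⟩ u S := by
    refine LipschitzOnWith.of_dist_le_mul fun x hx y hy => ?_
    rw [dist_eq_norm, dist_eq_norm]
    exact h1 x hx y hy
  obtain ⟨g, hg, hgu⟩ := hl.extend_real
  have hg' : ∀ x y, |g x - g y| ≤ k * ‖x - y‖ := fun x y => by
    have := hg.dist_le_mul x y
    rwa [dist_eq_norm, dist_eq_norm] at this
  refine ⟨fun x => max (-B) (min B (g x)), ⟨k + B, by positivity, fun x y => ?_, fun x => ?_⟩, fun x hx => ?_⟩
  · refine (abs_max_sub_max_le_max _ _ _ _).trans ?_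
    refine (max_le_max le_rfl (abs_min_sub_min_le_max _ _ _ _)).trans ?_
    have h3 : 0 ≤ (k + B) * ‖x - y‖ := by positivity
    simp only [sub_self, abs_zero]
    refine max_le h3 (max_le h3 ((hg' x y).trans ?_))
    gcongr
    linarith
  · rw [abs_le]
    constructor
    · exact le_trans (by linarith) (le_max_left _ _)
    · exact max_le (by linarith) ((min_le_left _ _).trans (by linarith))
  · have := abs_le.1 (h2 x hx)
    simp only [← hgu hx]
    rw [min_eq_right this.2, max_eq_right this.1]

lemma GoodPt.nearby {Ω : Set E3} {ρ u : E3 → ℝ} {p : E3} {r : ℝ}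
    (h : ∀ φ : E3 → ℝ, Lip φ → (∀ x, x ∉ Metric.ball p r → φ x = 0) →
      LL Ω ρ (fun x => u x * φ x) = 0) {q : E3} (hq : q ∈ Metric.ball p r) :
    GoodPt Ω ρ u q := by
  refine ⟨r - dist q p, sub_pos.2 hq, fun φ hφ h0 => h φ hφ fun x hx => h0 x fun hx' => hx ?_⟩
  rw [Metric.mem_ball] at *
  linarith [dist_triangle x q p]

/-- The set of bad points. -/
def BadSet (Ω : Set E3) (ρ u : E3 → ℝ) : Set E3 := {p | p ∈ closure Ω ∧ ¬ GoodPt Ω ρ u p}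

lemma BadSet.isClosed (Ω : Set E3) (ρ u : E3 → ℝ) : IsClosed (BadSet Ω ρ u) := by
  have h1 : IsOpen {p | GoodPt Ω ρ u p} := by
    rw [Metric.isOpen_iff]
    rintro p ⟨r, hr, h⟩
    exact ⟨r, hr, fun q hq => GoodPt.nearby h hq⟩
  exact isClosed_closure.inter h1.isClosed_compl

lemma step {Ω : Set E3} (hΩ : IsOpen Ω) (hb : Bornology.IsBounded Ω) {ρ u w φ : E3 → ℝ}
    (hρ : C2ext Ω ρ) (hN : WeakNeumann Ω ρ) (hu : Adm Ω u) (hw : Lip w) (hφ : Lip φ)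
    {p : E3} {r : ℝ} (h0 : ∀ x, x ∉ Metric.ball p r → φ x = 0)
    (H : ∀ ε > 0, ∃ δ m : ℝ, 0 < δ ∧ 0 ≤ m ∧
      (∀ x ∈ Ω, Metric.infDist x (BadSet Ω ρ u ∩ Metric.closedBall p r) ≤ 2 * δ →
        ∀ i, |pd i ρ x| * |u x - w x| ≤ m) ∧
      volume.real (Ω ∩ {x | Metric.infDist x (BadSet Ω ρ u ∩ Metric.closedBall p r) ≤ 2 * δ}) ≤ ε ∧
      m / δ * volume.real
        (Ω ∩ {x | Metric.infDist x (BadSet Ω ρ u ∩ Metric.closedBall p r) ≤ 2 * δ}) ≤ ε) :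
    LL Ω ρ (fun x => u x * φ x) = 0 := by
  set S := BadSet Ω ρ u ∩ Metric.closedBall p r with hS
  obtain ⟨C, hC, hest⟩ := est hΩ hb hρ (hu.sub (hw.adm Ω)) hφ
  have key : ∀ ε > 0, |LL Ω ρ (fun x => u x * φ x)| ≤ 2 * C * ε := by
    intro ε hε
    obtain ⟨δ, m, hδ, hm, h1, h2, h3⟩ := H ε hε
    have e1 := hest S δ m hδ hm h1
    have hc := cut_lip hδ S
    have e2 : LL Ω ρ (fun x => u x * (φ x * (1 - cut δ S x))) = 0 := by
      refine good_compact hΩ hb hρ hu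
        (K := closure Ω ∩ (Metric.closedBall p r ∩ {x | δ ≤ Metric.infDist x S})) ?_ ?_ _
        (hφ.mul ((Lip.const 1).sub hc)) ?_
      · exact hb.isCompact_closure.inter_right (Metric.isClosed_closedBall.inter
          (isClosed_le continuous_const (Metric.continuous_infDist_pt S)))
      · rintro q ⟨hq1, hq2, hq3⟩
        by_contra hcon
        have : q ∈ S := ⟨⟨hq1, hcon⟩, hq2⟩
        have h0 := Metric.infDist_zero_of_mem this
        have hq3' : δ ≤ Metric.infDist q S := hq3
        linarith
      · intro x hx hxK
        by_cases hxb : x ∈ Metric.ball p r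
        · have : Metric.infDist x S ≤ δ := by
            by_contra hcon
            exact hxK ⟨subset_closure hx, Metric.ball_subset_closedBall hxb, (not_le.1 hcon).le⟩
          rw [cut_eq_one hδ this]; ring
        · rw [h0 x hxb]; ring
    have e3 : LL Ω ρ (fun x => w x * (φ x * cut δ S x)) = 0 :=
      LL_lip hΩ hb hρ hN (hw.mul (hφ.mul hc))
    have a1 := hu.mul hΩ (hφ.adm Ω)
    have a2 := hu.mul hΩ ((hφ.mul ((Lip.const 1).sub hc)).adm Ω)
    have a3 := (hw.mul (hφ.mul hc)).adm Ω
    have s1 := LL_sub hΩ hb hρ a1 a2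
    have s2 := LL_sub hΩ hb hρ (a1.sub a2) a3
    have hfe : (fun x => u x * φ x - u x * (φ x * (1 - cut δ S x)) - w x * (φ x * cut δ S x))
        = fun x => (u x - w x) * (φ x * cut δ S x) := by
      funext x; ring
    rw [hfe, s1, e2, e3] at s2
    rw [sub_zero, sub_zero] at s2
    rw [s2] at e1
    refine e1.trans ?_
    have := mul_le_mul_of_nonneg_left h2 hC
    have := mul_le_mul_of_nonneg_left h3 hC
    linarith
  by_contra hne
  have hpos : 0 < |LL Ω ρ (fun x => u x * φ x)| := abs_pos.2 hne
  have := key (|LL Ω ρ (fun x => u x * φ x)| / (4 * C + 4)) (by positivity)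
  rw [mul_div_assoc', le_div_iff₀ (by positivity)] at this
  nlinarith

lemma caseD {Ω : Set E3} (hΩ : IsOpen Ω) (hb : Bornology.IsBounded Ω) {ρ u φ : E3 → ℝ}
    (hρ : C2ext Ω ρ) (hN : WeakNeumann Ω ρ) (hu : Adm Ω u) (hφ : Lip φ)
    {p : E3} {r : ℝ} (h0 : ∀ x, x ∉ Metric.ball p r → φ x = 0)
    (hne : (BadSet Ω ρ u ∩ Metric.closedBall p r).Nonempty)
    (hdis : ∀ x ∈ BadSet Ω ρ u ∩ Metric.closedBall p r, x ∉ Ω)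
    {Bu k : ℝ} (hBu : ∀ x ∈ closure Ω, |u x| ≤ Bu) (hk : 0 ≤ k)
    (hD : ∀ x ∈ BadSet Ω ρ u ∩ Metric.closedBall p r, ∀ q ∈ closure Ω,
      |u q - u x| ≤ k * ‖q - x‖) :
    LL Ω ρ (fun x => u x * φ x) = 0 := by
  set S := BadSet Ω ρ u ∩ Metric.closedBall p r with hS
  have hScl : IsClosed S := (BadSet.isClosed Ω ρ u).inter Metric.isClosed_closedBall
  have hSc : ∀ x ∈ S, x ∈ closure Ω := fun x hx => hx.1.1
  have hBu0 : 0 ≤ Bu := by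
    obtain ⟨x, hx⟩ := hne
    exact (abs_nonneg _).trans (hBu x (hSc x hx))
  obtain ⟨w, hw, hwu⟩ := lip_extend hk hBu0 (fun x hx y hy => hD y hy x (hSc x hx))
    (fun x hx => hBu x (hSc x hx))
  obtain ⟨B, hB0, hB1, hB2, hB3⟩ := exists_RB hb hρ
  refine step hΩ hb hρ hN hu hw hφ h0 ?_
  obtain ⟨K, hK, hK1, hK2⟩ := hw
  intro ε hε
  set A := B * (2 * (k + K)) with hA
  have hA0 : 0 ≤ A := by positivity
  obtain ⟨δ, hδ, hvol⟩ := small_nbhd hΩ hb hScl hne hdis (ε := ε / (1 + A)) (by positivity)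
  have hv := hvol δ le_rfl
  refine ⟨δ, A * δ, hδ, by positivity, ?_, ?_, ?_⟩
  · intro x hx hxd i
    obtain ⟨q, hq, hqd⟩ := hScl.exists_infDist_eq_dist hne x
    rw [hqd, dist_eq_norm] at hxd
    have h1 := hD q hq x (subset_closure hx)
    have h2 := hK1 x q
    have h3 : |u x - w x| ≤ (k + K) * (2 * δ) := by
      have : u x - w x = (u x - u q) - (w x - w q) := by rw [hwu q hq]; ring
      rw [this]
      refine (abs_sub _ _).trans ?_
      have := mul_le_mul_of_nonneg_left hxd (add_nonneg hk hK)
      linarith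
    have := mul_le_mul (hB2 x (subset_closure hx) i) h3 (abs_nonneg _) hB0
    rw [hA]
    linarith
  · refine hv.trans ?_
    exact div_le_self hε.le (by linarith)
  · rw [mul_div_assoc, div_self hδ.ne', mul_one]
    rw [le_div_iff₀ (by positivity)] at hv
    have : 0 ≤ volume.real (Ω ∩ {x | Metric.infDist x S ≤ 2 * δ}) := measureReal_nonneg
    linarith

lemma caseN {Ω : Set E3} (hΩ : IsOpen Ω) (hb : Bornology.IsBounded Ω) {ρ u φ : E3 → ℝ}
    (hρ : C2ext Ω ρ) (hN : WeakNeumann Ω ρ) (hu : Adm Ω u) (hφ : Lip φ)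
    {p : E3} {r : ℝ} (h0 : ∀ x, x ∉ Metric.ball p r → φ x = 0)
    (hne : (BadSet Ω ρ u ∩ Metric.closedBall p r).Nonempty)
    (hdis : ∀ x ∈ BadSet Ω ρ u ∩ Metric.closedBall p r, x ∉ Ω)
    {Bu k : ℝ} (hBu : ∀ x ∈ closure Ω, |u x| ≤ Bu) (hk : 1 ≤ k) (i₀ : Fin 3)
    (hz : ∀ x ∈ BadSet Ω ρ u ∩ Metric.closedBall p r, ∀ i, pd i ρ x = 0)
    (hcone : ∀ x ∈ BadSet Ω ρ u ∩ Metric.closedBall p r, ∀ q ∈ closure Ω, ∀ s : ℝ, 0 < s →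
      s ≤ 1 / k → ‖q - x - s • (EuclideanSpace.single i₀ (1 : ℝ) : E3)‖ < s / k →
      s / k ≤ |pd i₀ ρ q|) :
    LL Ω ρ (fun x => u x * φ x) = 0 := by
  set S := BadSet Ω ρ u ∩ Metric.closedBall p r with hS
  have hScl : IsClosed S := (BadSet.isClosed Ω ρ u).inter Metric.isClosed_closedBall
  have hSc : ∀ x ∈ S, x ∈ closure Ω := fun x hx => hx.1.1
  have hk0 : 0 < k := by linarith
  have hBu0 : 0 ≤ Bu := by
    obtain ⟨x, hx⟩ := hne
    exact (abs_nonneg _).trans (hBu x (hSc x hx))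
  obtain ⟨C, hC, hvolC⟩ := cone_nbhd hΩ hb hScl hne i₀ hk (by
    intro x hx q hq s hs hs1 hlt
    have := hcone x hx q (hSc q hq) s hs hs1 hlt
    rw [hz q hq i₀, abs_zero] at this
    have : 0 < s / k := by positivity
    linarith)
  refine step hΩ hb hρ hN hu (Lip.const 0) hφ h0 ?_
  intro ε hε
  obtain ⟨δ₁, hδ₁, hvol⟩ := small_nbhd hΩ hb hScl hne hdis hε
  set m := ε / (C + 1) with hm
  have hm0 : 0 < m := by positivity
  have huc : ∀ i, ∃ d > 0, ∀ x ∈ closure Ω, ∀ y ∈ closure Ω, dist x y < d →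
      dist (pd i ρ x) (pd i ρ y) < m / (Bu + 1) := fun i =>
    Metric.uniformContinuousOn_iff.1
      (hb.isCompact_closure.uniformContinuousOn_of_continuous (hρ.2.2.1 i)) _ (by positivity)
  choose d hd0 hd using huc
  have hev : ∀ᶠ n : ℕ in atTop, (1 : ℝ) / (5 * k ^ 2 * n) < δ₁ ∧
      ∀ i, (1 : ℝ) / (5 * k ^ 2 * n) < d i / 2 := by
    have t1 : Tendsto (fun n : ℕ => (1 : ℝ) / (5 * k ^ 2 * n)) atTop (nhds 0) := by
      have := (tendsto_one_div_atTop_nhds_zero_nat (𝕜 := ℝ)).const_mul (1 / (5 * k ^ 2))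
      rw [mul_zero] at this
      refine this.congr fun n => ?_
      rw [one_div_mul_one_div]
    refine (t1.eventually (gt_mem_nhds hδ₁)).and (eventually_all.2 fun i =>
      t1.eventually (gt_mem_nhds (half_pos (hd0 i))))
  obtain ⟨n, ⟨hn1, hn2⟩, hn0⟩ := (hev.and (eventually_gt_atTop 0)).exists
  have hn' : (0 : ℝ) < n := by exact_mod_cast hn0
  have hvn := hvolC n hn0
  set δ : ℝ := 1 / (5 * k ^ 2 * n) with hδ
  have hδ0 : 0 < δ := by positivity
  refine ⟨δ, m, hδ0, hm0.le, ?_, hvol δ hn1.le, ?_⟩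
  · intro x hx hxd i
    obtain ⟨q, hq, hqd⟩ := hScl.exists_infDist_eq_dist hne x
    rw [hqd] at hxd
    have h1 := hd i x (subset_closure hx) q (hSc q hq) (by linarith [hn2 i])
    rw [hz q hq i, Real.dist_eq, sub_zero] at h1
    rw [sub_zero]
    have h2 := mul_le_mul h1.le (hBu x (subset_closure hx)) (abs_nonneg _) (by positivity)
    refine h2.trans ?_
    rw [div_mul_eq_mul_div, div_le_iff₀ (by positivity)]
    nlinarith
  · have h1 := mul_le_mul_of_nonneg_left hvn (by positivity : 0 ≤ m / δ)
    refine h1.trans ?_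
    have : m / δ * (C * δ) = m * C := by field_simp
    rw [this, hm, div_mul_eq_mul_div, div_le_iff₀ (by positivity)]
    nlinarith

lemma sqpos_hasDerivAt (s : ℝ) : HasDerivAt (fun t : ℝ => (max t 0) ^ 2) (2 * max s 0) s := by
  rcases lt_trichotomy s 0 with h | h | h
  · have he : (fun t : ℝ => (max t 0) ^ 2) =ᶠ[nhds s] fun _ => 0 := by
      filter_upwards [gt_mem_nhds h] with t ht
      rw [max_eq_right ht.le]; ring
    rw [max_eq_right h.le, mul_zero]
    exact (hasDerivAt_const s (0 : ℝ)).congr_of_eventuallyEq he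
  · subst h
    rw [max_self, mul_zero]
    have : HasFDerivAt (fun t : ℝ => (max t 0) ^ 2) (0 : ℝ →L[ℝ] ℝ) 0 := by
      refine Asymptotics.IsBigO.hasFDerivAt (n := 2) ?_ (by norm_num)
      refine Asymptotics.IsBigO.of_bound 1 (Eventually.of_forall fun t => ?_)
      simp only [sub_zero, Real.norm_eq_abs, one_mul, abs_pow, abs_abs]
      have h1 : |max t 0| ≤ |t| := by
        rw [abs_of_nonneg (le_max_right _ _)]
        exact max_le (le_abs_self _) (abs_nonneg _)
      exact pow_le_pow_left₀ (abs_nonneg _) h1 2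
    simpa using this.hasDerivAt
  · have he : (fun t : ℝ => (max t 0) ^ 2) =ᶠ[nhds s] fun t => t ^ 2 := by
      filter_upwards [lt_mem_nhds h] with t ht
      rw [max_eq_left ht.le]
    rw [max_eq_left h.le]
    have := (hasDerivAt_pow 2 s).congr_of_eventuallyEq he
    simpa using this

/-- The truncated square. -/
def uu (ρ : E3 → ℝ) (κ : ℝ) (x : E3) : ℝ := (max (ρ x - κ) 0) ^ 2

lemma uu_fderiv {ρ : E3 → ℝ} (κ : ℝ) {x : E3} (h : DifferentiableAt ℝ ρ x) :
    HasFDerivAt (uu ρ κ) ((2 * max (ρ x - κ) 0) • fderiv ℝ ρ x) x := by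
  have h1 : HasFDerivAt (fun y => ρ y - κ) (fderiv ℝ ρ x) x := h.hasFDerivAt.sub_const κ
  exact (sqpos_hasDerivAt (ρ x - κ)).comp_hasFDerivAt x h1

lemma fderiv_norm_le {f : E3 → ℝ} {x : E3} {B : ℝ} (h : ∀ i, |pd i f x| ≤ B) :
    ‖fderiv ℝ f x‖ ≤ 3 * B := by
  have hB : 0 ≤ B := (abs_nonneg _).trans (h 0)
  refine ContinuousLinearMap.opNorm_le_bound _ (by positivity) fun y => ?_
  have hy : y = ∑ i : Fin 3, (y i) • (EuclideanSpace.single i (1 : ℝ) : E3) := by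
    ext j
    simp [Finset.sum_apply, Pi.single_apply]
  have h1 : fderiv ℝ f x y = ∑ i : Fin 3, (y i) * pd i f x := by
    conv_lhs => rw [hy]
    simp [pd]
  rw [h1, Real.norm_eq_abs]
  refine (Finset.abs_sum_le_sum_abs _ _).trans ?_
  have h2 : ∀ i ∈ (Finset.univ : Finset (Fin 3)), |y i * pd i f x| ≤ ‖y‖ * B := by
    intro i _
    rw [abs_mul]
    exact mul_le_mul (PiLp.norm_apply_le y i) (h i) (abs_nonneg _) (norm_nonneg _)
  refine (Finset.sum_le_sum h2).trans ?_
  simp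
  linarith

lemma uu_lip {ρ : E3 → ℝ} {κ B : ℝ} {x y : E3} (hx : |ρ x| ≤ B) (hy : |ρ y| ≤ B) :
    |uu ρ κ x - uu ρ κ y| ≤ 2 * (B + |κ|) * |ρ x - ρ y| := by
  unfold uu
  have hm : ∀ z, |ρ z| ≤ B → |max (ρ z - κ) 0| ≤ B + |κ| := by
    intro z hz
    have := abs_nonneg (ρ z)
    have := abs_nonneg κ
    rw [abs_of_nonneg (le_max_right _ _)]
    exact max_le (by linarith [le_abs_self (ρ z), neg_abs_le κ]) (by linarith)
  have h1 : max (ρ x - κ) 0 ^ 2 - max (ρ y - κ) 0 ^ 2 =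
    (max (ρ x - κ) 0 + max (ρ y - κ) 0) * (max (ρ x - κ) 0 - max (ρ y - κ) 0) := by ring
  rw [h1, abs_mul]
  have h2 : |max (ρ x - κ) 0 - max (ρ y - κ) 0| ≤ |ρ x - ρ y| := by
    have := abs_max_sub_max_le_abs (ρ x - κ) (ρ y - κ) 0
    rwa [sub_sub_sub_cancel_right] at this
  refine mul_le_mul ((abs_add_le _ _).trans ?_) h2 (abs_nonneg _) ?_
  · linarith [hm x hx, hm y hy]
  · have := (abs_nonneg _).trans hx
    positivity

lemma uu_bd {ρ : E3 → ℝ} {κ B : ℝ} {x : E3} (hx : |ρ x| ≤ B) : |uu ρ κ x| ≤ (B + |κ|) ^ 2 := by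
  unfold uu
  rw [abs_pow]
  refine pow_le_pow_left₀ (abs_nonneg _) ?_ 2
  have := abs_nonneg (ρ x)
  have := abs_nonneg κ
  rw [abs_of_nonneg (le_max_right _ _)]
  exact max_le (by linarith [le_abs_self (ρ x), neg_abs_le κ]) (by linarith)

lemma diff_of {Ω : Set E3} (hΩ : IsOpen Ω) {ρ : E3 → ℝ} (hρ : C2ext Ω ρ) {x : E3} (hx : x ∈ Ω) :
    DifferentiableAt ℝ ρ x :=
  (hρ.1.contDiffAt (hΩ.mem_nhds hx)).differentiableAt (by norm_num)

lemma uu_adm {Ω : Set E3} (hΩ : IsOpen Ω) (hb : Bornology.IsBounded Ω) {ρ : E3 → ℝ}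
    (hρ : C2ext Ω ρ) (κ : ℝ) : Adm Ω (uu ρ κ) := by
  obtain ⟨B, hB0, hB1, hB2, hB3⟩ := exists_RB hb hρ
  refine ⟨fun x hx => (uu_fderiv κ (diff_of hΩ hρ hx)).continuousAt.continuousWithinAt,
    (B + |κ|) ^ 2 + 2 * (B + |κ|) * (3 * B), by positivity, fun x hx => ?_, ?_⟩
  · have := uu_bd (κ := κ) (hB1 x (subset_closure hx))
    have : 0 ≤ 2 * (B + |κ|) * (3 * B) := by positivity
    linarith
  · filter_upwards [ae_restrict_mem hΩ.measurableSet] with x hx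
    have h1 := uu_fderiv κ (diff_of hΩ hρ hx)
    refine ⟨h1.differentiableAt, ?_⟩
    rw [h1.fderiv, norm_smul]
    have h2 := fderiv_norm_le (hB2 x (subset_closure hx))
    have h3 : ‖2 * max (ρ x - κ) 0‖ ≤ 2 * (B + |κ|) := by
      have := le_abs_self (ρ x)
      have := hB1 x (subset_closure hx)
      have := neg_abs_le κ
      have := abs_nonneg κ
      rw [Real.norm_eq_abs, abs_of_nonneg (by positivity)]
      have : max (ρ x - κ) 0 ≤ B + |κ| := max_le (by linarith) (by linarith)
      linarith
    have := mul_le_mul h3 h2 (norm_nonneg _) (by positivity)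
    nlinarith [sq_nonneg (B + |κ|)]

lemma good_interior {Ω : Set E3} (hΩ : IsOpen Ω) (hb : Bornology.IsBounded Ω) {ρ : E3 → ℝ}
    (hρ : C2ext Ω ρ) (hN : WeakNeumann Ω ρ) (κ : ℝ) {p : E3} (hp : p ∈ Ω) :
    GoodPt Ω ρ (uu ρ κ) p := by
  obtain ⟨B, hB0, hB1, hB2, hB3⟩ := exists_RB hb hρ
  obtain ⟨K, t, ht, hK⟩ := ((hρ.1.contDiffAt (hΩ.mem_nhds hp)).of_le
    (by norm_num : (1 : WithTop ℕ∞) ≤ 2)).exists_lipschitzOnWith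
  obtain ⟨r, hr, hball⟩ := Metric.mem_nhds_iff.1 (Filter.inter_mem ht (hΩ.mem_nhds hp))
  refine ⟨r, hr, fun φ hφ h0 => ?_⟩
  obtain ⟨w, hw, hwu⟩ := lip_extend (S := Metric.ball p r) (u := uu ρ κ)
    (k := 2 * (B + |κ|) * K) (B := (B + |κ|) ^ 2) (by positivity) (by positivity)
    (fun x hx y hy => by
      refine (uu_lip (hB1 x (subset_closure (hball hx).2)) (hB1 y (subset_closure (hball hy).2))).trans ?_
      have := hK.dist_le_mul x (hball hx).1 y (hball hy).1
      rw [dist_eq_norm, dist_eq_norm, Real.norm_eq_abs] at this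
      rw [mul_assoc _ (K : ℝ)]
      exact mul_le_mul_of_nonneg_left this (by positivity))
    (fun x hx => uu_bd (hB1 x (subset_closure (hball hx).2)))
  rw [← LL_lip hΩ hb hρ hN (hw.mul hφ)]
  refine LL_congr hΩ fun x _ => ?_
  by_cases hx : x ∈ Metric.ball p r
  · rw [hwu x hx]
  · rw [h0 x hx, mul_zero, mul_zero]

lemma good_low {Ω : Set E3} (hΩ : IsOpen Ω) {ρ : E3 → ℝ}
    (hρ : C2ext Ω ρ) {κ : ℝ} {p : E3} (hp : p ∈ closure Ω) (hlt : ρ p < κ) :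
    GoodPt Ω ρ (uu ρ κ) p := by
  have hev := (hρ.2.1 p hp).eventually (gt_mem_nhds hlt)
  obtain ⟨r, hr, h⟩ := Metric.mem_nhdsWithin_iff.1 hev
  refine ⟨r, hr, fun φ hφ h0 => ?_⟩
  have : LL Ω ρ (fun _ => 0) = 0 := by simp [LL, pd]
  rw [← this]
  refine LL_congr hΩ fun x hx => ?_
  by_cases hxb : x ∈ Metric.ball p r
  · have h1 : ρ x < κ := h ⟨hxb, subset_closure hx⟩
    unfold uu
    rw [max_eq_right (by linarith)]; ring
  · rw [h0 x hxb, mul_zero]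

/-- Closed pieces of the boundary where `ρ` is pointwise Lipschitz. -/
def DD (Ω : Set E3) (ρ : E3 → ℝ) (k : ℕ) : Set E3 :=
  {p | p ∈ closure Ω ∧ ∀ q ∈ closure Ω, |ρ q - ρ p| ≤ k * ‖q - p‖}

/-- Closed pieces of the boundary with vanishing gradient and a cone condition. -/
def NN (Ω : Set E3) (ρ : E3 → ℝ) (i : Fin 3) (k : ℕ) : Set E3 :=
  {p | p ∈ closure Ω ∧ (∀ j, pd j ρ p = 0) ∧ ∀ q ∈ closure Ω, ∀ s : ℝ, 0 < s →
      s ≤ 1 / ((k : ℝ) + 1) →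
      ‖q - p - s • (EuclideanSpace.single i (1 : ℝ) : E3)‖ < s / ((k : ℝ) + 1) →
      s / ((k : ℝ) + 1) ≤ |pd i ρ q|}

lemma seq_lim {Ω : Set E3} {f : E3 → ℝ} (hf : ContinuousOn f (closure Ω)) {x : ℕ → E3} {p : E3}
    (hx : ∀ n, x n ∈ closure Ω) (hp : p ∈ closure Ω) (hl : Tendsto x atTop (nhds p)) :
    Tendsto (fun n => f (x n)) atTop (nhds (f p)) :=
  (hf p hp).tendsto.comp (tendsto_nhdsWithin_iff.2 ⟨hl, Eventually.of_forall hx⟩)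

lemma DD_closed {Ω : Set E3} {ρ : E3 → ℝ} (hρ : C2ext Ω ρ) (k : ℕ) : IsClosed (DD Ω ρ k) := by
  refine IsSeqClosed.isClosed fun x p hx hl => ?_
  have hp : p ∈ closure Ω := isClosed_closure.isSeqClosed (fun n => (hx n).1) hl
  refine ⟨hp, fun q hq => ?_⟩
  have h1 := seq_lim hρ.2.1 (fun n => (hx n).1) hp hl
  exact le_of_tendsto_of_tendsto' (h1.const_sub _).abs ((hl.const_sub q).norm.const_mul _)
    fun n => (hx n).2 q hq

lemma NN_closed {Ω : Set E3} {ρ : E3 → ℝ} (hρ : C2ext Ω ρ) (i : Fin 3) (k : ℕ) :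
    IsClosed (NN Ω ρ i k) := by
  refine IsSeqClosed.isClosed fun x p hx hl => ?_
  have hp : p ∈ closure Ω := isClosed_closure.isSeqClosed (fun n => (hx n).1) hl
  refine ⟨hp, fun j => ?_, fun q hq s hs hs1 hlt => ?_⟩
  · have h1 := seq_lim (hρ.2.2.1 j) (fun n => (hx n).1) hp hl
    refine tendsto_nhds_unique h1 ?_
    simp only [(hx _).2.1 j]
    exact tendsto_const_nhds
  · have h1 : Tendsto (fun n => ‖q - x n - s • (EuclideanSpace.single i (1 : ℝ) : E3)‖) atTop
      (nhds ‖q - p - s • (EuclideanSpace.single i (1 : ℝ) : E3)‖) :=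
      ((hl.const_sub q).sub_const _).norm
    obtain ⟨n, hn⟩ := (h1.eventually (gt_mem_nhds hlt)).exists
    exact (hx n).2.2 q hq s hs hs1 hn

lemma mem_DD {Ω : Set E3} (hb : Bornology.IsBounded Ω) {ρ : E3 → ℝ} (hρ : C2ext Ω ρ) {p : E3}
    (hp : p ∈ closure Ω) (hd : DifferentiableAt ℝ ρ p) : ∃ k, p ∈ DD Ω ρ k := by
  obtain ⟨B, hB0, hB1, hB2, hB3⟩ := exists_RB hb hρ
  obtain ⟨c, hc⟩ := hd.hasFDerivAt.isBigO_sub.bound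
  obtain ⟨d, hd0, hd⟩ := Metric.eventually_nhds_iff.1 hc
  obtain ⟨k, hk⟩ := exists_nat_ge (max c (2 * B / d))
  refine ⟨k, hp, fun q hq => ?_⟩
  by_cases hqd : dist q p < d
  · have := hd hqd
    rw [Real.norm_eq_abs] at this
    exact this.trans (mul_le_mul_of_nonneg_right ((le_max_left _ _).trans hk) (norm_nonneg _))
  · rw [not_lt, dist_eq_norm] at hqd
    have h1 : |ρ q - ρ p| ≤ 2 * B := (abs_sub _ _).trans (by linarith [hB1 q hq, hB1 p hp])
    have h2 : 2 * B / d ≤ k := (le_max_right _ _).trans hk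
    rw [div_le_iff₀ hd0] at h2
    have := mul_le_mul_of_nonneg_left hqd (Nat.cast_nonneg (α := ℝ) k)
    linarith

lemma mem_NN {Ω : Set E3} {ρ : E3 → ℝ} {p : E3}
    (hp : p ∈ closure Ω) (hd : ¬ DifferentiableAt ℝ ρ p) (hl : lap ρ p ≠ 0) :
    ∃ i k, p ∈ NN Ω ρ i k := by
  have hz : ∀ j, pd j ρ p = 0 := fun j => by
    unfold pd
    rw [fderiv_zero_of_not_differentiableAt hd]; rfl
  obtain ⟨i, -, hi⟩ : ∃ i ∈ Finset.univ, pd i (pd i ρ) p ≠ 0 := Finset.exists_ne_zero_of_sum_ne_zero hl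
  have hdi : DifferentiableAt ℝ (pd i ρ) p := by
    by_contra hcon
    apply hi
    change fderiv ℝ (pd i ρ) p _ = 0
    rw [fderiv_zero_of_not_differentiableAt hcon]; rfl
  set e : E3 := EuclideanSpace.single i (1 : ℝ) with he
  have hen : ‖e‖ = 1 := by simp [he]
  set l := fderiv ℝ (pd i ρ) p with hldef
  have hle : l e = pd i (pd i ρ) p := rfl
  set c := |l e| / 4 with hc
  have hc0 : 0 < c := by
    have : 0 < |l e| := abs_pos.2 (by rw [hle]; exact hi)
    positivity
  have hb := (hdi.hasFDerivAt.isLittleO).bound hc0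
  obtain ⟨d, hd0, hd⟩ := Metric.eventually_nhds_iff.1 hb
  obtain ⟨k, hk⟩ := exists_nat_ge (max ((‖l‖ + 1) / (2 * c)) (2 / d))
  refine ⟨i, k, hp, hz, fun q hq s hs hs1 hlt => ?_⟩
  have hK0 : (0 : ℝ) < (k : ℝ) + 1 := by positivity
  have hK1 : (‖l‖ + 1) / (2 * c) ≤ (k : ℝ) + 1 := ((le_max_left _ _).trans hk).trans (by linarith)
  have hK2 : 2 / d < (k : ℝ) + 1 := ((le_max_right _ _).trans hk).trans_lt (by linarith)
  set K : ℝ := (k : ℝ) + 1 with hKdef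
  have hK11 : 1 ≤ K := by
    have := Nat.cast_nonneg (α := ℝ) k
    linarith
  have hsK : s / K ≤ s := div_le_self hs.le hK11
  have hqp : ‖q - p‖ ≤ 2 * s := by
    have : q - p = (q - p - s • e) + s • e := by abel
    rw [this]
    refine (norm_add_le _ _).trans ?_
    rw [norm_smul, hen, mul_one, Real.norm_eq_abs, abs_of_pos hs]
    linarith
  have hqd : dist q p < d := by
    rw [dist_eq_norm]
    have h1 : 2 * (1 / K) < d := by
      rw [div_lt_iff₀ hd0] at hK2
      rw [mul_one_div, div_lt_iff₀ hK0]
      linarith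
    linarith
  have h1 := hd hqd
  rw [hz i, sub_zero, Real.norm_eq_abs] at h1
  have h2 : l (q - p) = l (q - p - s • e) + s * l e := by
    rw [map_sub l (q - p), map_smul]; simp
  have h3 : |l (q - p - s • e)| ≤ ‖l‖ * (s / K) :=
    (l.le_opNorm _).trans (mul_le_mul_of_nonneg_left hlt.le (norm_nonneg _))
  have h4 : |s * l e| = s * (4 * c) := by
    rw [abs_mul, abs_of_pos hs, hc]; ring
  have h5 : s * l e = pd i ρ q - (pd i ρ q - l (q - p)) - l (q - p - s • e) := by
    rw [h2]; ring
  have h6 : |s * l e| ≤ |pd i ρ q| + |pd i ρ q - l (q - p)| + |l (q - p - s • e)| := by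
    rw [h5]
    exact (abs_sub _ _).trans (add_le_add_left (abs_sub _ _) _)
  have h7 : (‖l‖ + 1) * (s / K) ≤ 2 * c * s := by
    rw [div_le_iff₀ (by positivity)] at hK1
    rw [mul_div_assoc', div_le_iff₀ hK0]
    nlinarith
  have h8 := mul_le_mul_of_nonneg_left hqp hc0.le
  nlinarith

lemma bad_empty {Ω : Set E3} (hΩ : IsOpen Ω) (hb : Bornology.IsBounded Ω) {ρ : E3 → ℝ}
    (hρ : C2ext Ω ρ) (hN : WeakNeumann Ω ρ) {κ : ℝ}
    (hlap : ∀ p ∈ closure Ω, κ ≤ ρ p → 0 < lap ρ p) : BadSet Ω ρ (uu ρ κ) = ∅ := by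
  by_contra hcon
  have hSne : (BadSet Ω ρ (uu ρ κ)).Nonempty := Set.nonempty_iff_ne_empty.2 hcon
  obtain ⟨B, hB0, hB1, hB2, hB3⟩ := exists_RB hb hρ
  have hScl := BadSet.isClosed Ω ρ (uu ρ κ)
  have hu := uu_adm hΩ hb hρ κ
  have hdisj : ∀ x ∈ BadSet Ω ρ (uu ρ κ), x ∉ Ω := fun x hx hxΩ =>
    hx.2 (good_interior hΩ hb hρ hN κ hxΩ)
  have hge : ∀ x ∈ BadSet Ω ρ (uu ρ κ), κ ≤ ρ x := fun x hx => by
    by_contra hlt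
    exact hx.2 (good_low hΩ hρ hx.1 (not_le.1 hlt))
  let F : ℕ ⊕ (Fin 3 × ℕ) → Set E3 := Sum.elim (DD Ω ρ) (fun a => NN Ω ρ a.1 a.2)
  have hFcl : ∀ j, IsClosed (F j) := by
    rintro (k | ⟨i, k⟩)
    · exact DD_closed hρ k
    · exact NN_closed hρ i k
  have hcov : ∀ x ∈ BadSet Ω ρ (uu ρ κ), ∃ j, x ∈ F j := by
    intro x hx
    by_cases hd : DifferentiableAt ℝ ρ x
    · obtain ⟨k, hk⟩ := mem_DD hb hρ hx.1 hd
      exact ⟨Sum.inl k, hk⟩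
    · obtain ⟨i, k, hk⟩ := mem_NN hx.1 hd (hlap x hx.1 (hge x hx)).ne'
      exact ⟨Sum.inr (i, k), hk⟩
  have : Nonempty (BadSet Ω ρ (uu ρ κ)) := hSne.to_subtype
  have : CompleteSpace (BadSet Ω ρ (uu ρ κ)) := hScl.completeSpace_coe
  obtain ⟨j, ⟨p, hpS⟩, hp⟩ := nonempty_interior_of_iUnion_of_closed
    (f := fun j => (Subtype.val : BadSet Ω ρ (uu ρ κ) → E3) ⁻¹' F j)
    (fun j => (hFcl j).preimage continuous_subtype_val)
    (Set.eq_univ_of_forall fun x => Set.mem_iUnion.2 (hcov x.1 x.2))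
  obtain ⟨r, hr, hball⟩ := Metric.mem_nhds_iff.1 (mem_interior_iff_mem_nhds.1 hp)
  have hsub : ∀ x ∈ BadSet Ω ρ (uu ρ κ) ∩ Metric.closedBall p (r / 2), x ∈ F j := by
    rintro x ⟨hx, hxr⟩
    have hm : (⟨x, hx⟩ : BadSet Ω ρ (uu ρ κ)) ∈ Metric.ball (⟨p, hpS⟩ : BadSet Ω ρ (uu ρ κ)) r := by
      rw [Metric.mem_ball, Subtype.dist_eq]
      exact lt_of_le_of_lt (Metric.mem_closedBall.1 hxr) (by linarith)
    exact hball hm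
  have hne : (BadSet Ω ρ (uu ρ κ) ∩ Metric.closedBall p (r / 2)).Nonempty :=
    ⟨p, hpS, Metric.mem_closedBall_self (by linarith)⟩
  have hdis : ∀ x ∈ BadSet Ω ρ (uu ρ κ) ∩ Metric.closedBall p (r / 2), x ∉ Ω :=
    fun x hx => hdisj x hx.1
  have hBu : ∀ x ∈ closure Ω, |uu ρ κ x| ≤ (B + |κ|) ^ 2 := fun x hx => uu_bd (hB1 x hx)
  refine hpS.2 ⟨r / 2, by linarith, fun φ hφ h0 => ?_⟩
  rcases j with k | ⟨i, k⟩
  · refine caseD hΩ hb hρ hN hu hφ h0 hne hdis hBu (k := 2 * (B + |κ|) * k) (by positivity) ?_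
    intro x hx q hq
    have h1 := (hsub x hx).2 q hq
    refine (uu_lip (hB1 q hq) (hB1 x hx.1.1)).trans ?_
    rw [mul_assoc _ (k : ℝ)]
    exact mul_le_mul_of_nonneg_left h1 (by positivity)
  · refine caseN hΩ hb hρ hN hu hφ h0 hne hdis hBu (k := (k : ℝ) + 1) (by
      have : (0 : ℝ) ≤ k := Nat.cast_nonneg k
      linarith) i ?_ ?_
    · exact fun x hx => (hsub x hx).2.1
    · exact fun x hx => (hsub x hx).2.2

lemma main_lemma {Ω : Set E3} (hΩ : IsOpen Ω) (hb : Bornology.IsBounded Ω) {ρ : E3 → ℝ}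
    (hρ : C2ext Ω ρ) (hN : WeakNeumann Ω ρ) {κ : ℝ}
    (hlap : ∀ p ∈ closure Ω, κ ≤ ρ p → 0 < lap ρ p) : ∀ x ∈ Ω, ρ x ≤ κ := by
  have hbad := bad_empty hΩ hb hρ hN hlap
  have hu := uu_adm hΩ hb hρ κ
  have hLL : LL Ω ρ (uu ρ κ) = 0 := by
    have := good_compact hΩ hb hρ hu hb.isCompact_closure (fun p hp => by
      by_contra hcon
      have : p ∈ BadSet Ω ρ (uu ρ κ) := ⟨hp, hcon⟩
      rw [hbad] at this
      exact this) (fun _ => 1) (Lip.const 1) (fun x hx hx' => absurd (subset_closure hx) hx')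
    simpa using this
  obtain ⟨hi1, hi2⟩ := LL_int hΩ hb hρ hu
  have hnn1 : ∀ x ∈ Ω, 0 ≤ lap ρ x * uu ρ κ x := by
    intro x hx
    by_cases h : κ ≤ ρ x
    · exact mul_nonneg (hlap x (subset_closure hx) h).le (sq_nonneg _)
    · have : uu ρ κ x = 0 := by
        unfold uu
        rw [max_eq_right (by linarith)]; ring
      rw [this, mul_zero]
  have hnn2 : ∀ x ∈ Ω, 0 ≤ ∑ i : Fin 3, pd i ρ x * pd i (uu ρ κ) x := by
    intro x hx
    refine Finset.sum_nonneg fun i _ => ?_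
    have h1 : pd i (uu ρ κ) x = 2 * max (ρ x - κ) 0 * pd i ρ x := by
      unfold pd
      rw [(uu_fderiv κ (diff_of hΩ hρ hx)).fderiv]; rfl
    rw [h1]
    have : 0 ≤ max (ρ x - κ) 0 := le_max_right _ _
    have := mul_nonneg this (mul_self_nonneg (pd i ρ x))
    nlinarith
  have hae := (setIntegral_eq_zero_iff_of_nonneg_ae (f := fun x => lap ρ x * uu ρ κ x +
    ∑ i : Fin 3, pd i ρ x * pd i (uu ρ κ) x) (by
      filter_upwards [ae_restrict_mem hΩ.measurableSet] with x hx
      exact add_nonneg (hnn1 x hx) (hnn2 x hx)) (hi1.add hi2)).1 hLL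
  have hae2 : (fun x => lap ρ x * uu ρ κ x) =ᵐ[volume.restrict Ω] fun _ => 0 := by
    filter_upwards [ae_restrict_mem hΩ.measurableSet, hae] with x hx h
    have h' : lap ρ x * uu ρ κ x + ∑ i : Fin 3, pd i ρ x * pd i (uu ρ κ) x = 0 := h
    linarith [hnn1 x hx, hnn2 x hx]
  have heq := Measure.eqOn_open_of_ae_eq hae2 hΩ
    (((lap_cont hρ).mono subset_closure).mul hu.1) continuousOn_const
  intro x hx
  by_contra hlt
  have h1 : lap ρ x * uu ρ κ x = 0 := heq hx
  have h2 := hlap x (subset_closure hx) (not_le.1 hlt).le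
  have h3 : 0 < uu ρ κ x := by
    unfold uu
    have : 0 < max (ρ x - κ) 0 := lt_max_of_lt_left (by linarith [not_le.1 hlt])
    positivity
  exact absurd h1 (mul_pos h2 h3).ne'

lemma second_deriv_nonpos {Ω : Set E3} (hΩ : IsOpen Ω) {ρ : E3 → ℝ} (hρ : C2ext Ω ρ) {z : E3}
    (hz : z ∈ Ω) (hmax : IsLocalMax ρ z) (i : Fin 3) : pd i (pd i ρ) z ≤ 0 := by
  by_contra hpos
  push Not at hpos
  set e : E3 := EuclideanSpace.single i (1 : ℝ) with he
  have hline : ∀ t : ℝ, HasDerivAt (fun s : ℝ => z + s • e) e t := fun t => by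
    simpa using ((hasDerivAt_id t).smul_const e).const_add z
  have hcont : Continuous (fun s : ℝ => z + s • e) := by fun_prop
  have hg0 : z + (0 : ℝ) • e = z := by simp
  have hnear : ∀ᶠ t : ℝ in nhds 0, z + t • e ∈ Ω :=
    hcont.continuousAt.eventually_mem (by rw [hg0]; exact hΩ.mem_nhds hz)
  set g : ℝ → ℝ := fun t => ρ (z + t • e) with hg
  have hd1 : ∀ t, z + t • e ∈ Ω → HasDerivAt g (pd i ρ (z + t • e)) t := fun t ht =>
    (diff_of hΩ hρ ht).hasFDerivAt.comp_hasDerivAt t (hline t)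
  have hd1e : deriv g =ᶠ[nhds 0] fun t => pd i ρ (z + t • e) := by
    filter_upwards [hnear] with t ht using (hd1 t ht).deriv
  have hdz : DifferentiableAt ℝ (pd i ρ) z := by
    by_contra hcon
    have : pd i (pd i ρ) z = 0 := by
      rw [pd, fderiv_zero_of_not_differentiableAt hcon]; rfl
    linarith
  have hd2 : HasDerivAt (fun t : ℝ => pd i ρ (z + t • e)) (pd i (pd i ρ) z) 0 := by
    have h1 : HasFDerivAt (pd i ρ) (fderiv ℝ (pd i ρ) z) (z + (0 : ℝ) • e) := by
      rw [hg0]; exact hdz.hasFDerivAt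
    exact h1.comp_hasDerivAt 0 (hline 0)
  have hdd : deriv (deriv g) 0 = pd i (pd i ρ) z := by
    rw [hd1e.deriv_eq]; exact hd2.deriv
  have hgmax : IsLocalMax g 0 := by
    have h1 : Tendsto (fun s : ℝ => z + s • e) (nhds 0) (nhds z) := by
      have := hcont.tendsto 0
      rwa [hg0] at this
    have h2 := h1.eventually hmax
    filter_upwards [h2] with t ht
    simpa [hg] using ht
  have hgmin : IsLocalMin g 0 := by
    refine isLocalMin_of_deriv_deriv_pos (by rw [hdd]; exact hpos) hgmax.deriv_eq_zero ?_
    exact (hd1 0 (by rw [hg0]; exact hz)).continuousAt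
  have hconst : g =ᶠ[nhds 0] fun _ => g 0 := by
    filter_upwards [hgmax, hgmin] with t h1 h2 using le_antisymm h1 h2
  have : deriv (deriv g) 0 = 0 := by
    have h1 : deriv g =ᶠ[nhds 0] deriv (fun _ : ℝ => g 0) := hconst.deriv
    rw [h1.deriv_eq]; simp
  linarith

lemma upper_bound {Ω : Set E3} (hΩ : IsOpen Ω) (hb : Bornology.IsBounded Ω)
    {τ θ : ℝ} (hτ : 0 < τ) (hθ : 0 < θ) {v : Fin 3 → E3 → ℝ} (hv : TestVF Ω v) {M : ℝ}
    {ρn : E3 → ℝ} (hM : ∀ x ∈ Ω, ρn x ≤ M) {ρ : E3 → ℝ} (hρ : C2ext Ω ρ)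
    (hPDE : ∀ x ∈ Ω,
      (ρ x - ρn x) / τ + ∑ i : Fin 3, v i x * pd i ρ x = θ * lap ρ x)
    (hN : WeakNeumann Ω ρ) : ∀ x ∈ Ω, ρ x ≤ M := by
  by_contra! hcon
  obtain ⟨x1, hx1, hlt1⟩ := hcon
  obtain ⟨x0, hx0, hmax⟩ := hb.isCompact_closure.exists_isMaxOn ⟨x1, subset_closure hx1⟩ hρ.2.1
  have hmax : ∀ y ∈ closure Ω, ρ y ≤ ρ x0 := hmax
  have hM0 : M < ρ x0 := hlt1.trans_le (hmax x1 (subset_closure hx1))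
  set V : Set E3 := ⋃ i, tsupport (v i) with hV
  have hVc : IsCompact V := isCompact_iUnion fun i => (hv.1 i).2.1
  have hVΩ : V ⊆ Ω := Set.iUnion_subset fun i => (hv.1 i).2.2
  have hv0 : ∀ x, x ∉ V → ∀ i, v i x = 0 := fun x hx i =>
    image_eq_zero_of_notMem_tsupport fun h => hx (Set.mem_iUnion.2 ⟨i, h⟩)
  have hVlt : ∀ z ∈ V, ρ z < ρ x0 := by
    intro z hz
    by_contra hge
    push Not at hge
    have hzΩ := hVΩ hz
    have hloc : IsLocalMax ρ z := by
      filter_upwards [hΩ.mem_nhds hzΩ] with y hy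
      exact (hmax y (subset_closure hy)).trans hge
    have hfd : ∀ i, pd i ρ z = 0 := fun i => by
      rw [pd, hloc.fderiv_eq_zero]; rfl
    have hl : lap ρ z ≤ 0 := Finset.sum_nonpos fun i _ => second_deriv_nonpos hΩ hρ hzΩ hloc i
    have h1 := hPDE z hzΩ
    simp only [hfd, mul_zero, Finset.sum_const_zero, add_zero] at h1
    have h2 : 0 < (ρ z - ρn z) / τ := div_pos (by linarith [hM z hzΩ]) hτ
    nlinarith
  obtain ⟨κ, hκM, hκV, hκ0⟩ : ∃ κ, M < κ ∧ (∀ z ∈ V, ρ z < κ) ∧ κ < ρ x0 := by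
    rcases V.eq_empty_or_nonempty with hVe | hVn
    · obtain ⟨κ, h1, h2⟩ := exists_between hM0
      exact ⟨κ, h1, by simp [hVe], h2⟩
    · obtain ⟨y, hy, hymax⟩ := hVc.exists_isMaxOn hVn
        (hρ.2.1.mono (hVΩ.trans subset_closure))
      obtain ⟨κ, h1, h2⟩ := exists_between (max_lt hM0 (hVlt y hy))
      exact ⟨κ, (le_max_left _ _).trans_lt h1,
        fun z hz => lt_of_le_of_lt (hymax hz) ((le_max_right _ _).trans_lt h1), h2⟩
  have hle := main_lemma hΩ hb hρ hN (κ := κ) (by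
    intro p hp hκp
    have hpV : p ∉ V := fun h => absurd (hκV p h) (not_lt.2 hκp)
    have hev : ∀ᶠ x in nhdsWithin p Ω, (ρ x - M) / τ ≤ θ * lap ρ x := by
      have h1 : ∀ᶠ x in nhdsWithin p Ω, x ∉ V :=
        nhdsWithin_le_nhds (hVc.isClosed.isOpen_compl.mem_nhds hpV)
      filter_upwards [h1, self_mem_nhdsWithin] with x hxV hx
      have h2 := hPDE x hx
      simp only [hv0 x hxV, zero_mul, Finset.sum_const_zero, add_zero] at h2
      rw [← h2]
      exact div_le_div_of_nonneg_right (by linarith [hM x hx]) hτ.le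
    have : (nhdsWithin p Ω).NeBot := mem_closure_iff_nhdsWithin_neBot.1 hp
    have t1 : Tendsto ρ (nhdsWithin p Ω) (nhds (ρ p)) :=
      (hρ.2.1 p hp).mono_left (nhdsWithin_mono p subset_closure)
    have t2 : Tendsto (lap ρ) (nhdsWithin p Ω) (nhds (lap ρ p)) :=
      (lap_cont hρ p hp).mono_left (nhdsWithin_mono p subset_closure)
    have hlim := le_of_tendsto_of_tendsto ((t1.sub_const M).div_const τ) (t2.const_mul θ) hev
    have h3 : 0 < (ρ p - M) / τ := div_pos (by linarith) hτ
    exact pos_of_mul_pos_right (h3.trans_le hlim) hθ.le)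
  have hcl : ρ x0 ≤ κ := by
    have : (nhdsWithin x0 Ω).NeBot := mem_closure_iff_nhdsWithin_neBot.1 hx0
    have t1 : Tendsto ρ (nhdsWithin x0 Ω) (nhds (ρ x0)) :=
      (hρ.2.1 x0 hx0).mono_left (nhdsWithin_mono x0 subset_closure)
    refine le_of_tendsto t1 ?_
    filter_upwards [self_mem_nhdsWithin] with x hx using hle x hx
  linarith

lemma pd_neg_fun (i : Fin 3) (f : E3 → ℝ) : pd i (fun x => -f x) = fun x => -pd i f x := by
  funext x
  unfold pd
  rw [fderiv_fun_neg]; rfl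

lemma lap_neg_fun (f : E3 → ℝ) (x : E3) : lap (fun x => -f x) x = -lap f x := by
  unfold lap
  simp [pd_neg_fun]

/-- Proposition 3.2 (second part): maximum principle for the time-discrete
elliptic step: if `m ≤ ρⁿ ≤ M` on `Ω`, then `m ≤ ρ ≤ M` on `Ω`. -/
theorem statement4 (Ω : Set E3) (hΩo : IsOpen Ω) (hΩb : Bornology.IsBounded Ω)
    (τ θ : ℝ) (hτ : 0 < τ) (hθ : 0 < θ)
    (v : Fin 3 → E3 → ℝ) (hv : TestVF Ω v)
    (m M : ℝ) (hmM : m ≤ M)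
    (ρn : E3 → ℝ) (hρn : ContinuousOn ρn Ω)
    (hρnbd : ∀ x ∈ Ω, m ≤ ρn x ∧ ρn x ≤ M)
    (ρ : E3 → ℝ) (hρ : C2ext Ω ρ)
    (hPDE : ∀ x ∈ Ω,
      (ρ x - ρn x) / τ + ∑ i : Fin 3, v i x * pd i ρ x = θ * lap ρ x)
    (hN : WeakNeumann Ω ρ) :
    ∀ x ∈ Ω, m ≤ ρ x ∧ ρ x ≤ M := by
  have hup := upper_bound hΩo hΩb hτ hθ hv (fun x hx => (hρnbd x hx).2) hρ hPDE hN
  have hρ' : C2ext Ω (fun x => -ρ x) := by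
    refine ⟨hρ.1.neg, hρ.2.1.neg, fun i => ?_, fun i j => ?_⟩
    · rw [pd_neg_fun]; exact (hρ.2.2.1 i).neg
    · rw [pd_neg_fun, pd_neg_fun]; exact (hρ.2.2.2 i j).neg
  have hPDE' : ∀ x ∈ Ω, ((fun x => -ρ x) x - (fun x => -ρn x) x) / τ +
      ∑ i : Fin 3, v i x * pd i (fun x => -ρ x) x = θ * lap (fun x => -ρ x) x := by
    intro x hx
    have h := hPDE x hx
    simp only [pd_neg_fun, lap_neg_fun, mul_neg, Finset.sum_neg_distrib]
    rw [← h]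
    ring
  have hN' : WeakNeumann Ω (fun x => -ρ x) := by
    intro w h1 h2 h3
    have h := hN w h1 h2 h3
    simp only [pd_neg_fun, lap_neg_fun, neg_mul, Finset.sum_neg_distrib]
    rw [integral_neg, integral_neg, h]
  have hlow := upper_bound hΩo hΩb hτ hθ hv (M := -m)
    (fun x hx => neg_le_neg (hρnbd x hx).1) hρ' hPDE' hN'
  intro x hx
  exact ⟨neg_le_neg_iff.1 (hlow x hx), hup x hx⟩
end
end

section
/- Let Ω ⊆ ℝ³ be a nonempty bounded open set. For every λ > 0 there exists a constant Ã_λ ≥ 0 such that for every g ∈ C_c^∞(Ω): ‖g‖_{L²(Ω)} ≤ λ ( ‖g‖²_{L²(Ω)} + ∑_{i=1}^3 ‖∂_{x_i}g‖²_{L²(Ω)} )^{1/2} + Ã_λ sup_{φ ∈ S̃} | ∫_Ω g φ dx |, where S̃ is the set of all φ ∈ C_c^∞(Ω) with max( sup_{x∈Ω}|φ(x)|, max_{1≤i≤3} sup_{x∈Ω}|∂_{x_i}φ(x)| ) = 1. -/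
open MeasureTheory Filter

noncomputable section

open scoped Convolution ContDiff Manifold

/-- Cauchy–Schwarz for real integrals. -/
lemma aux_cs {α : Type*} [MeasurableSpace α] {μ : Measure α} {u v : α → ℝ}
    (hu : MemLp u 2 μ) (hv : MemLp v 2 μ) :
    ∫ a, |u a| * |v a| ∂μ ≤ Real.sqrt (∫ a, (u a)^2 ∂μ) * Real.sqrt (∫ a, (v a)^2 ∂μ) := by
  have h := integral_mul_norm_le_Lp_mul_Lq (μ := μ) (f := u) (g := v) Real.HolderConjugate.two_two
    (by simpa using hu) (by simpa using hv)
  simpa [Real.sqrt_eq_rpow] using h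

lemma aux_opnorm (L : E3 →L[ℝ] ℝ) : ‖L‖^2 ≤ ∑ i : Fin 3, (L (EuclideanSpace.single i 1))^2 := by
  have h : ‖L‖ ≤ Real.sqrt (∑ i : Fin 3, (L (EuclideanSpace.single i 1))^2) := by
    refine L.opNorm_le_bound (Real.sqrt_nonneg _) fun x => ?_
    have hx : x = ∑ i : Fin 3, x i • (EuclideanSpace.single i (1:ℝ) : E3) := by
      ext j
      simp [Finset.sum_apply, Pi.single_apply]
    have hL : L x = ∑ i : Fin 3, L (EuclideanSpace.single i 1) * x i := by
      conv_lhs => rw [hx]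
      simp [map_sum, mul_comm]
    have hc := Finset.sum_mul_sq_le_sq_mul_sq Finset.univ
      (fun i : Fin 3 => L (EuclideanSpace.single i 1)) (fun i => x i)
    rw [← hL, ← EuclideanSpace.real_norm_sq_eq] at hc
    rw [Real.norm_eq_abs]
    refine abs_le_of_sq_le_sq ?_ (by positivity)
    rw [mul_pow, Real.sq_sqrt (by positivity)]
    exact hc
  calc ‖L‖^2 ≤ _ := pow_le_pow_left₀ (norm_nonneg _) h 2
    _ = _ := Real.sq_sqrt (by positivity)

/-- The autocorrelation of `g` is Lipschitz with constant `‖g‖₂ ‖∇g‖₂`. -/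
lemma aux_autocorr {g : E3 → ℝ} (hg : ContDiff ℝ (⊤ : ℕ∞) g) (hc : HasCompactSupport g) (z : E3) :
    |(∫ x, g x * g (x - z)) - ∫ x, g x * g x| ≤
      Real.sqrt (∫ x, (g x)^2) * Real.sqrt (∫ x, ‖fderiv ℝ g x‖^2) * ‖z‖ := by
  set gt : E3 → ℝ := fun y => g (-y) with hgt
  have hgt1 : ContDiff ℝ 1 gt := (hg.of_le (by exact_mod_cast le_top)).comp contDiff_neg
  have hgtc : HasCompactSupport gt := hc.comp_homeomorph (Homeomorph.neg E3)
  have hd : ∀ z, HasFDerivAt (g ⋆[ContinuousLinearMap.mul ℝ ℝ, volume] gt)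
      ((g ⋆[(ContinuousLinearMap.mul ℝ ℝ).precompR E3, volume] fderiv ℝ gt) z) z :=
    fun z => hgtc.hasFDerivAt_convolution_right _ hg.continuous.locallyIntegrable hgt1 z
  have hfd : ∀ y, ‖fderiv ℝ gt y‖ = ‖fderiv ℝ g (-y)‖ := by
    intro y
    have : fderiv ℝ gt y = - fderiv ℝ g (-y) := by
      have h1 : HasFDerivAt g (fderiv ℝ g (-y)) (-y) :=
        (hg.differentiable (by simp)).differentiableAt.hasFDerivAt
      have h2 := (h1.comp y (hasFDerivAt_id y).neg).fderiv
      have h3 : fderiv ℝ gt y = _ := h2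
      rw [h3]
      ext v; simp
    rw [this, norm_neg]
  have hcf : Continuous (fderiv ℝ g) := hg.continuous_fderiv (by simp)
  have hbound : ∀ z ∈ (Set.univ : Set E3),
      ‖(g ⋆[(ContinuousLinearMap.mul ℝ ℝ).precompR E3, volume] fderiv ℝ gt) z‖ ≤
      Real.sqrt (∫ x, (g x)^2) * Real.sqrt (∫ x, ‖fderiv ℝ g x‖^2) := by
    intro z _
    have hcomp : HasCompactSupport (fun t => ‖fderiv ℝ g (t - z)‖) := by
      have := (hc.fderiv ℝ).norm.comp_homeomorph (Homeomorph.subRight z)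
      exact this
    have hm2 : MemLp (fun t => ‖fderiv ℝ g (t - z)‖) 2 (volume : Measure E3) :=
      Continuous.memLp_of_hasCompactSupport (by fun_prop) hcomp
    have hm1 : MemLp g 2 (volume : Measure E3) :=
      hg.continuous.memLp_of_hasCompactSupport hc
    rw [convolution_def]
    calc _ ≤ ∫ t, ‖((ContinuousLinearMap.mul ℝ ℝ).precompR E3) (g t) (fderiv ℝ gt (z - t))‖ :=
          norm_integral_le_integral_norm _
      _ ≤ ∫ t, |g t| * |‖fderiv ℝ g (t - z)‖| := by
          apply integral_mono_of_nonneg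
          · exact Eventually.of_forall fun t => norm_nonneg _
          · exact (hm1.abs.integrable_mul hm2.abs)
          · refine Eventually.of_forall fun t => ?_
            have : ((ContinuousLinearMap.mul ℝ ℝ).precompR E3) (g t) (fderiv ℝ gt (z - t))
              = g t • fderiv ℝ gt (z - t) := by
              ext v; simp [ContinuousLinearMap.precompR_apply]
            simp only [this, norm_smul, hfd, abs_norm, neg_sub, Real.norm_eq_abs, le_refl]
      _ ≤ _ := aux_cs hm1 hm2
      _ = _ := by
          rw [integral_sub_right_eq_self (fun t => ‖fderiv ℝ g t‖^2) z]
  have := convex_univ.norm_image_sub_le_of_norm_hasFDerivWithin_le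
    (fun z _ => (hd z).hasFDerivWithinAt) hbound (Set.mem_univ (0:E3)) (Set.mem_univ z)
  simpa [convolution_def, hgt] using this

/-- Smooth cutoff functions. -/
lemma aux_cutoff {Ω : Set E3} (hΩo : IsOpen Ω) (hΩb : Bornology.IsBounded Ω) {ε : ℝ} (hε : 0 < ε) :
    ∃ χ : E3 → ℝ, TestFun Ω χ ∧ (∀ x, χ x ∈ Set.Icc (0:ℝ) 1) ∧
      ∫ x in Ω, (1 - χ x)^2 ≤ ε := by
  have hfin : volume Ω ≠ ⊤ := hΩb.measure_lt_top.ne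
  obtain ⟨K, hKΩ, hK, hlt⟩ := hΩo.measurableSet.exists_isCompact_sdiff_lt hfin
    (ε := ENNReal.ofReal ε) (by simpa using hε)
  obtain ⟨K', hK', hKK', hK'Ω⟩ := exists_compact_between hK hΩo hKΩ
  obtain ⟨f, h1, h0, hI⟩ := exists_contMDiffMap_one_nhds_of_subset_interior (n := (⊤ : ℕ∞)) 𝓘(ℝ, E3)
    hK.isClosed hKK'
  have hts : tsupport f ⊆ K' := by
    apply closure_minimal _ hK'.isClosed
    intro x hx
    by_contra h
    exact hx (h0 x h)
  refine ⟨f, ⟨f.contMDiff.contDiff, ?_, hts.trans hK'Ω⟩, hI, ?_⟩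
  · exact hK'.of_isClosed_subset (isClosed_tsupport _) hts
  · have hmeas : MeasurableSet (Ω \ K) := hΩo.measurableSet.diff hK.measurableSet
    calc ∫ x in Ω, (1 - f x)^2 ≤ ∫ x in Ω, (Ω \ K).indicator (fun _ => (1:ℝ)) x := by
          apply integral_mono_of_nonneg
          · exact Eventually.of_forall fun x => sq_nonneg _
          · exact ((integrable_indicator_iff hmeas).2
              (integrableOn_const (by
                exact (measure_mono Set.sdiff_subset |>.trans_lt hfin.lt_top).ne))).restrict
          · filter_upwards [ae_restrict_mem hΩo.measurableSet] with x hx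
            by_cases hxK : x ∈ K
            · have : f x = 1 := h1.self_of_nhdsSet x hxK
              simp [this, hxK]
            · have := hI x
              simp only [Set.mem_sdiff, hx, hxK, not_false_eq_true, and_self,
                Set.indicator_of_mem]
              nlinarith [this.1, this.2]
      _ = volume.real (Ω \ K) := by
          rw [setIntegral_indicator hmeas, setIntegral_const, Set.inter_eq_self_of_subset_right Set.sdiff_subset]
          simp
      _ ≤ ε := ENNReal.toReal_le_of_le_ofReal hε.le hlt.le

lemma aux_bdd {f : E3 → ℝ} (hf : Continuous f) (hc : HasCompactSupport f) :
    ∃ C, 0 ≤ C ∧ ∀ x, |f x| ≤ C := by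
  obtain ⟨C, hC⟩ := hf.bounded_above_of_compact_support hc
  exact ⟨C, (norm_nonneg _).trans (hC 0), hC⟩

lemma aux_pd_cont {f : E3 → ℝ} (hf : ContDiff ℝ (⊤ : ℕ∞) f) (i : Fin 3) : Continuous (pd i f) :=
  (hf.continuous_fderiv (by simp)).clm_apply continuous_const

lemma aux_pd_supp {f : E3 → ℝ} (hc : HasCompactSupport f) (i : Fin 3) :
    HasCompactSupport (pd i f) :=
  hc.fderiv_apply ℝ (EuclideanSpace.single i 1)

/-- The `W^{1,∞}` norm on `Ω`. -/
def WN (Ω : Set E3) (φ : E3 → ℝ) : ℝ :=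
  max (⨆ x : Ω, |φ (x:E3)|) (⨆ i : Fin 3, ⨆ x : Ω, |pd i φ (x:E3)|)

lemma aux_WN_nonneg (Ω : Set E3) (φ : E3 → ℝ) : 0 ≤ WN Ω φ :=
  le_max_of_le_left (Real.iSup_nonneg fun _ => abs_nonneg _)

lemma aux_le_WN {Ω : Set E3} {φ : E3 → ℝ} (h : TestFun Ω φ) {x : E3} (hx : x ∈ Ω) :
    |φ x| ≤ WN Ω φ := by
  obtain ⟨C, -, hC⟩ := aux_bdd h.1.continuous h.2.1
  exact le_max_of_le_left
    (le_ciSup (f := fun x : Ω => |φ (x:E3)|) ⟨C, by rintro _ ⟨y, rfl⟩; exact hC y⟩ ⟨x, hx⟩)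

lemma aux_WN_smul {Ω : Set E3} {φ : E3 → ℝ} (h : TestFun Ω φ) {c : ℝ} (hc : 0 ≤ c) :
    WN Ω (fun x => c * φ x) = c * WN Ω φ := by
  have hpd : ∀ i x, pd i (fun x => c * φ x) x = c * pd i φ x := by
    intro i x
    unfold pd
    rw [fderiv_const_mul (h.1.differentiable (by simp)).differentiableAt]
    simp
  unfold WN
  simp only [hpd, abs_mul, abs_of_nonneg hc]
  simp only [← Real.mul_iSup_of_nonneg hc]
  exact (mul_max_of_nonneg _ _ hc).symm

lemma aux_sup {Ω : Set E3} (hΩo : IsOpen Ω) (hne : Ω.Nonempty) {g ψ : E3 → ℝ}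
    (hg : TestFun Ω g) (hψ : TestFun Ω ψ) {C : ℝ} (h0 : ∀ x, |ψ x| ≤ C)
    (h1 : ∀ i x, |pd i ψ x| ≤ C) :
    |∫ x in Ω, g x * ψ x| ≤ C * ⨆ φ : {φ : E3 → ℝ // TestFun Ω φ ∧
                max (⨆ x : Ω, |φ (x:E3)|) (⨆ i : Fin 3, ⨆ x : Ω, |pd i φ (x:E3)|) = 1},
                |∫ x in Ω, g x * φ.1 x| := by
  have hC : 0 ≤ C := (abs_nonneg _).trans (h0 0)
  have hS : 0 ≤ ⨆ φ : {φ : E3 → ℝ // TestFun Ω φ ∧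
                max (⨆ x : Ω, |φ (x:E3)|) (⨆ i : Fin 3, ⨆ x : Ω, |pd i φ (x:E3)|) = 1},
                |∫ x in Ω, g x * φ.1 x| := Real.iSup_nonneg fun _ => abs_nonneg _
  have : Nonempty Ω := hne.to_subtype
  have hN : WN Ω ψ ≤ C := max_le (ciSup_le fun x => h0 x) (ciSup_le fun i => ciSup_le fun x => h1 i x)
  have hgi : Integrable g (volume.restrict Ω) :=
    (hg.1.continuous.integrable_of_hasCompactSupport hg.2.1).restrict
  rcases (aux_WN_nonneg Ω ψ).eq_or_lt with hz | hpos
  · have : ∫ x in Ω, g x * ψ x = 0 := by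
      rw [setIntegral_congr_fun (g := fun _ => (0:ℝ)) hΩo.measurableSet]
      · simp
      · intro x hx
        have := aux_le_WN hψ hx
        rw [← hz] at this
        have : ψ x = 0 := abs_nonpos_iff.1 this
        simp [this]
    rw [this, abs_zero]
    positivity
  · set N := WN Ω ψ with hNdef
    have hT : TestFun Ω (fun x => N⁻¹ * ψ x) :=
      ⟨contDiff_const.mul hψ.1, hψ.2.1.mul_left,
        (tsupport_mul_subset_right (f := fun _ => N⁻¹) (g := ψ)).trans hψ.2.2⟩
    have hW : WN Ω (fun x => N⁻¹ * ψ x) = 1 := by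
      rw [aux_WN_smul hψ (by positivity), ← hNdef, inv_mul_cancel₀ hpos.ne']
    have hle := le_ciSup (f := fun φ : {φ : E3 → ℝ // TestFun Ω φ ∧
                max (⨆ x : Ω, |φ (x:E3)|) (⨆ i : Fin 3, ⨆ x : Ω, |pd i φ (x:E3)|) = 1} =>
                |∫ x in Ω, g x * φ.1 x|) ?_ ⟨_, hT, hW⟩
    · have he : ∫ x in Ω, g x * ψ x = N * ∫ x in Ω, g x * (N⁻¹ * ψ x) := by
        rw [← integral_const_mul]
        congr 1; ext x; field_simp
      rw [he, abs_mul, abs_of_pos hpos]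
      exact mul_le_mul hN hle (abs_nonneg _) hC
    · refine ⟨∫ x in Ω, |g x|, ?_⟩
      rintro _ ⟨φ, rfl⟩
      refine abs_integral_le_integral_abs.trans ?_
      apply integral_mono_of_nonneg
      · exact Eventually.of_forall fun x => abs_nonneg _
      · exact hgi.abs
      · filter_upwards [ae_restrict_mem hΩo.measurableSet] with x hx
        have h3 : |φ.1 x| ≤ 1 := (aux_le_WN φ.2.1 hx).trans φ.2.2.le
        simp only [abs_mul]
        exact mul_le_of_le_one_right (abs_nonneg _) h3

/-- Averaging the autocorrelation against a mollifier. -/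
lemma aux_moll {g ρ : E3 → ℝ} (hg : ContDiff ℝ (⊤ : ℕ∞) g) (hc : HasCompactSupport g)
    (hρ : Continuous ρ) (hρc : HasCompactSupport ρ) (hρ0 : ∀ x, 0 ≤ ρ x) (hρ1 : ∫ x, ρ x = 1)
    {δ : ℝ} (hδ : ∀ x, ρ x ≠ 0 → ‖x‖ ≤ δ) :
    ∫ x, (g x)^2 ≤ δ * (Real.sqrt (∫ x, (g x)^2) * Real.sqrt (∫ x, ‖fderiv ℝ g x‖^2))
      + ∫ x, g x * ∫ y, g y * ρ (x - y) := by
  set D := Real.sqrt (∫ x, (g x)^2) * Real.sqrt (∫ x, ‖fderiv ℝ g x‖^2) with hD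
  have hD0 : 0 ≤ D := by positivity
  have hgc := hg.continuous
  have hswap : ∫ x, g x * ∫ y, g y * ρ (x - y) = ∫ z, ρ z * ∫ x, g x * g (x - z) := by
    have e1 : ∀ x, g x * ∫ y, g y * ρ (x - y) = ∫ z, ρ z * (g x * g (x - z)) := by
      intro x
      rw [← integral_sub_left_eq_self (fun y => g y * ρ (x - y)) volume x, ← integral_const_mul]
      congr 1; ext z; simp; ring
    simp_rw [e1, ← integral_const_mul]
    apply integral_integral_swap_of_hasCompactSupport
    · unfold Function.uncurry; fun_prop
    · refine HasCompactSupport.intro (hc.isCompact.prod hρc.isCompact) ?_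
      rintro ⟨x, z⟩ hxz
      simp only [Set.mem_prod, not_and_or] at hxz
      rcases hxz with h | h
      · simp [Function.uncurry, image_eq_zero_of_notMem_tsupport h]
      · simp [Function.uncurry, image_eq_zero_of_notMem_tsupport h]
  have hρi : Integrable ρ := hρ.integrable_of_hasCompactSupport hρc
  have hpt : ∀ z, ρ z * ((∫ x, (g x)^2) - δ * D) ≤ ρ z * ∫ x, g x * g (x - z) := by
    intro z
    by_cases hz : ρ z = 0
    · simp [hz]
    · have h1 := aux_autocorr hg hc z
      have h2 : D * ‖z‖ ≤ δ * D := by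
        rw [mul_comm]; exact mul_le_mul_of_nonneg_right (hδ z hz) hD0
      rw [← hD] at h1
      have h3 := (abs_le.1 h1).1
      simp only [← pow_two] at h3
      exact mul_le_mul_of_nonneg_left (by linarith) (hρ0 z)
  have hint : Integrable fun z => ρ z * ∫ x, g x * g (x - z) := by
    apply Continuous.integrable_of_hasCompactSupport _ hρc.mul_right
    apply hρ.mul
    have heq : (fun z => ∫ x, g x * g (x - z)) =
        (g ⋆[ContinuousLinearMap.mul ℝ ℝ, volume] (fun y => g (-y))) := by
      ext z; simp [convolution_def]
    rw [heq]
    exact HasCompactSupport.continuous_convolution_right _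
      (hc.comp_homeomorph (Homeomorph.neg E3)) hgc.locallyIntegrable (hgc.comp continuous_neg)
  have := integral_mono (hρi.mul_const _) hint hpt
  rw [integral_mul_const, hρ1, ← hswap] at this
  linarith

lemma aux_pd_prod {χ ρ : E3 → ℝ} (hχ : ContDiff ℝ (⊤ : ℕ∞) χ) (hρ : ContDiff ℝ (⊤ : ℕ∞) ρ)
    (x y : E3) (i : Fin 3) :
    pd i (fun y => χ y * ρ (x - y)) y = pd i χ y * ρ (x - y) - χ y * pd i ρ (x - y) := by
  have h1 : HasFDerivAt χ (fderiv ℝ χ y) y :=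
    (hχ.differentiable (by simp)).differentiableAt.hasFDerivAt
  have h2 : HasFDerivAt ρ (fderiv ℝ ρ (x - y)) (x - y) :=
    (hρ.differentiable (by simp)).differentiableAt.hasFDerivAt
  have h3 := (h1.mul (h2.comp y ((hasFDerivAt_id y).const_sub x))).fderiv
  have h4 : fderiv ℝ (fun y => χ y * ρ (x - y)) y = _ := h3
  unfold pd
  rw [h4]
  simp
  ring

lemma aux_glob {Ω : Set E3} {f g : E3 → ℝ} (hg : tsupport g ⊆ Ω) (h : ∀ x, g x = 0 → f x = 0) :
    ∫ x in Ω, f x = ∫ x, f x :=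
  setIntegral_eq_integral_of_forall_compl_eq_zero fun x hx =>
    h x (image_eq_zero_of_notMem_tsupport fun hx' => hx (hg hx'))

/-- The Aubin–Lions-type interpolation inequality (4.3): for every `λ > 0` there
is `Ã_λ ≥ 0` with `‖g‖_{L²} ≤ λ‖g‖_{H¹} + Ã_λ sup_{φ∈S̃} |∫_Ω gφ|` for every
`g ∈ C_c^∞(Ω)`, where `S̃ = {φ ∈ C_c^∞(Ω) : ‖φ‖_{W^{1,∞}} = 1}`. -/
theorem statement17 (Ω : Set E3) (hΩo : IsOpen Ω) (hΩb : Bornology.IsBounded Ω)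
    (hne : Ω.Nonempty) :
    ∀ lam : ℝ, 0 < lam → ∃ A : ℝ, 0 ≤ A ∧
      ∀ g : E3 → ℝ, TestFun Ω g →
        Real.sqrt (∫ x in Ω, (g x)^2)
          ≤ lam * Real.sqrt ((∫ x in Ω, (g x)^2)
              + ∑ i : Fin 3, ∫ x in Ω, (pd i g x)^2)
            + A * ⨆ φ : {φ : E3 → ℝ // TestFun Ω φ ∧
                max (⨆ x : Ω, |φ (x:E3)|) (⨆ i : Fin 3, ⨆ x : Ω, |pd i φ (x:E3)|) = 1},
                |∫ x in Ω, g x * φ.1 x| := by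
  intro lam hlam
  have hfin : volume Ω ≠ ⊤ := hΩb.measure_lt_top.ne
  have : IsFiniteMeasure (volume.restrict Ω) := ⟨by simpa using hfin.lt_top⟩
  obtain ⟨ρ, hρ, hρc, hρ0, hρ1, hρδ⟩ : ∃ ρ : E3 → ℝ, ContDiff ℝ (⊤ : ℕ∞) ρ ∧ HasCompactSupport ρ ∧
      (∀ x, 0 ≤ ρ x) ∧ ∫ x, ρ x = 1 ∧ ∀ x, ρ x ≠ 0 → ‖x‖ ≤ lam / 2 := by
    let b : ContDiffBump (0 : E3) := ⟨lam / 4, lam / 2, by positivity, by linarith⟩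
    refine ⟨b.normed volume, b.contDiff_normed, b.hasCompactSupport_normed,
      b.nonneg_normed, b.integral_normed, fun x hx => ?_⟩
    have : x ∈ Function.support (b.normed volume) := hx
    rw [b.support_normed_eq] at this
    simpa using (Metric.mem_ball.1 this).le
  obtain ⟨M, hM0, hM⟩ := aux_bdd hρ.continuous hρc
  choose M1 hM10 hM1 using fun i => aux_bdd (aux_pd_cont hρ i) (aux_pd_supp hρc i)
  set V : ℝ := Real.sqrt (volume.real Ω) with hV
  have hV0 : 0 ≤ V := Real.sqrt_nonneg _
  set η : ℝ := lam / 2 / (V * M + 1) with hη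
  have hη0 : 0 < η := by positivity
  have hη1 : V * M * η ≤ lam / 2 := by
    have : (V * M + 1) * η = lam / 2 := by rw [hη]; field_simp
    nlinarith
  obtain ⟨χ, hχ, hχI, hχε⟩ := aux_cutoff hΩo hΩb (ε := η^2) (by positivity)
  choose B hB0 hB using fun i => aux_bdd (aux_pd_cont hχ.1 i) (aux_pd_supp hχ.2.1 i)
  have hχa : ∀ x, |χ x| ≤ 1 := fun x => abs_le.2 ⟨by linarith [(hχI x).1], (hχI x).2⟩
  set C : ℝ := M + (∑ i, B i) * M + ∑ i, M1 i with hC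
  have hSB : 0 ≤ ∑ i, B i := Finset.sum_nonneg fun i _ => hB0 i
  have hSM : 0 ≤ ∑ i, M1 i := Finset.sum_nonneg fun i _ => hM10 i
  have hC0 : 0 ≤ C := by positivity
  refine ⟨V * C, by positivity, fun g hg => ?_⟩
  set S := ⨆ φ : {φ : E3 → ℝ // TestFun Ω φ ∧
                max (⨆ x : Ω, |φ (x:E3)|) (⨆ i : Fin 3, ⨆ x : Ω, |pd i φ (x:E3)|) = 1},
                |∫ x in Ω, g x * φ.1 x| with hS
  have hS0 : 0 ≤ S := Real.iSup_nonneg fun _ => abs_nonneg _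
  have hgc := hg.1.continuous
  have hχc := hχ.1.continuous
  have hρcont := hρ.continuous
  have hg2 : ∫ x in Ω, (g x)^2 = ∫ x, (g x)^2 := aux_glob hg.2.2 (by intro x hx; simp [hx])
  set a := Real.sqrt (∫ x in Ω, (g x)^2) with ha
  have ha0 : 0 ≤ a := Real.sqrt_nonneg _
  have hasq : a^2 = ∫ x in Ω, (g x)^2 := Real.sq_sqrt (integral_nonneg fun x => sq_nonneg _)
  have hgL : MemLp g 2 (volume.restrict Ω) :=
    (hgc.memLp_of_hasCompactSupport hg.2.1).restrict Ω
  have hχL : MemLp (fun x => 1 - χ x) 2 (volume.restrict Ω) :=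
    (memLp_const 1).sub ((hχc.memLp_of_hasCompactSupport hχ.2.1).restrict Ω)
  -- pointwise bound of the mollification
  have hG : ∀ x, |∫ y, g y * ρ (x - y)| ≤ C * S + M * η * a := by
    intro x
    have hψ : TestFun Ω (fun y => χ y * ρ (x - y)) :=
      ⟨hχ.1.mul (hρ.comp (contDiff_const.sub contDiff_id)), hχ.2.1.mul_right,
        (tsupport_mul_subset_left (f := χ) (g := fun y => ρ (x - y))).trans hχ.2.2⟩
    have h1 : |∫ y in Ω, g y * (χ y * ρ (x - y))| ≤ C * S := by
      refine aux_sup hΩo hne hg hψ (fun y => ?_) (fun i y => ?_)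
      · rw [abs_mul]
        have := mul_le_mul (hχa y) (hM (x - y)) (abs_nonneg _) zero_le_one
        have h5 : 0 ≤ (∑ i, B i) * M := by positivity
        linarith
      · rw [aux_pd_prod hχ.1 hρ]
        refine (abs_sub _ _).trans ?_
        rw [abs_mul, abs_mul]
        have e1 := mul_le_mul (hB i y) (hM (x - y)) (abs_nonneg _) (hB0 i)
        have e2 := mul_le_mul (hχa y) (hM1 i (x - y)) (abs_nonneg _) zero_le_one
        have e3 : B i ≤ ∑ i, B i := Finset.single_le_sum (fun j _ => hB0 j) (Finset.mem_univ i)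
        have e4 : M1 i ≤ ∑ i, M1 i := Finset.single_le_sum (fun j _ => hM10 j) (Finset.mem_univ i)
        have e5 := mul_le_mul_of_nonneg_right e3 hM0
        linarith
    have h2 : |∫ y in Ω, g y * ((1 - χ y) * ρ (x - y))| ≤ M * η * a := by
      refine abs_integral_le_integral_abs.trans ?_
      calc ∫ y in Ω, |g y * ((1 - χ y) * ρ (x - y))| ≤ ∫ y in Ω, M * (|g y| * |1 - χ y|) := by
            apply integral_mono_of_nonneg
            · exact Eventually.of_forall fun _ => abs_nonneg _
            · exact (hgL.abs.integrable_mul hχL.abs).const_mul M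
            · refine Eventually.of_forall fun y => ?_
              simp only [abs_mul]
              have := mul_le_mul_of_nonneg_left (hM (x - y))
                (mul_nonneg (abs_nonneg (g y)) (abs_nonneg (1 - χ y)))
              linarith
        _ = M * ∫ y in Ω, |g y| * |1 - χ y| := integral_const_mul _ _
        _ ≤ M * (a * η) := by
            apply mul_le_mul_of_nonneg_left _ hM0
            refine (aux_cs hgL hχL).trans (mul_le_mul_of_nonneg_left ?_ ha0)
            exact Real.sqrt_le_iff.2 ⟨hη0.le, hχε⟩
        _ = _ := by ring
    have h3 : ∫ y, g y * ρ (x - y) = (∫ y in Ω, g y * (χ y * ρ (x - y)))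
        + ∫ y in Ω, g y * ((1 - χ y) * ρ (x - y)) := by
      rw [← aux_glob hg.2.2 (f := fun y => g y * ρ (x - y)) (by intro y hy; simp [hy]),
        ← integral_add]
      · congr 1; ext y; ring
      · exact (Continuous.integrable_of_hasCompactSupport (by fun_prop) hg.2.1.mul_right).restrict
      · exact (Continuous.integrable_of_hasCompactSupport (by fun_prop) hg.2.1.mul_right).restrict
    rw [h3]
    exact (abs_add_le _ _).trans (add_le_add h1 h2)
  set T := C * S + M * η * a with hT
  have hT0 : 0 ≤ T := by positivity
  have hGG : ∫ x, g x * ∫ y, g y * ρ (x - y) ≤ T * (a * V) := by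
    rw [← aux_glob hg.2.2 (f := fun x => g x * ∫ y, g y * ρ (x - y)) (by intro y hy; simp [hy])]
    calc ∫ x in Ω, g x * ∫ y, g y * ρ (x - y) ≤ |∫ x in Ω, g x * ∫ y, g y * ρ (x - y)| :=
          le_abs_self _
      _ ≤ ∫ x in Ω, |g x * ∫ y, g y * ρ (x - y)| := abs_integral_le_integral_abs
      _ ≤ ∫ x in Ω, T * (|g x| * |(1:ℝ)|) := by
          apply integral_mono_of_nonneg
          · exact Eventually.of_forall fun _ => abs_nonneg _
          · exact (hgL.abs.integrable_mul (memLp_const (p := 2) (|(1:ℝ)|))).const_mul T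
          · refine Eventually.of_forall fun x => ?_
            simp only [abs_mul, abs_one, mul_one]
            have := mul_le_mul_of_nonneg_left (hG x) (abs_nonneg (g x))
            linarith
      _ = T * ∫ x in Ω, |g x| * |(1:ℝ)| := integral_const_mul _ _
      _ ≤ T * (a * V) := by
          apply mul_le_mul_of_nonneg_left _ hT0
          refine (aux_cs hgL (memLp_const (1:ℝ))).trans (mul_le_mul_of_nonneg_left ?_ ha0)
          simp [hV]
  have hmain := aux_moll hg.1 hg.2.1 hρcont hρc hρ0 hρ1 hρδ
  rw [← hg2, ← ha, ← hasq] at hmain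
  -- gradient
  have hgrad : ∫ x, ‖fderiv ℝ g x‖^2 ≤ ∑ i : Fin 3, ∫ x in Ω, (pd i g x)^2 := by
    have hi : ∀ i, Integrable fun x => (pd i g x)^2 := fun i =>
      Continuous.integrable_of_hasCompactSupport ((aux_pd_cont hg.1 i).pow 2)
        ((aux_pd_supp hg.2.1 i).comp_left (g := fun t : ℝ => t^2) (by simp))
    have e : ∀ i, ∫ x in Ω, (pd i g x)^2 = ∫ x, (pd i g x)^2 := by
      intro i
      refine aux_glob (g := pd i g) ?_ (by intro x hx; simp [hx])
      exact (tsupport_fderiv_apply_subset ℝ (EuclideanSpace.single i 1)).trans hg.2.2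
    simp_rw [e]
    rw [← integral_finsetSum _ fun i _ => hi i]
    apply integral_mono_of_nonneg
    · exact Eventually.of_forall fun _ => sq_nonneg _
    · exact integrable_finsetSum _ fun i _ => hi i
    · exact Eventually.of_forall fun x => aux_opnorm (fderiv ℝ g x)
  set D := Real.sqrt (∫ x, ‖fderiv ℝ g x‖^2) with hD
  set H := Real.sqrt ((∫ x in Ω, (g x)^2) + ∑ i : Fin 3, ∫ x in Ω, (pd i g x)^2) with hH
  have hDH : D ≤ H := by
    apply Real.sqrt_le_sqrt
    rw [← hasq]; nlinarith [sq_nonneg a]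
  have haH : a ≤ H := by
    apply Real.sqrt_le_sqrt
    have : 0 ≤ ∫ x, ‖fderiv ℝ g x‖^2 := integral_nonneg fun _ => sq_nonneg _
    linarith
  have hfin1 : a * a ≤ a * (lam / 2 * D + V * T) := by nlinarith
  rcases ha0.eq_or_lt with h0 | hpos
  · rw [← h0]
    have : 0 ≤ H := Real.sqrt_nonneg _
    positivity
  · have h6 := le_of_mul_le_mul_left hfin1 hpos
    have h7 : V * M * η * a ≤ lam / 2 * H :=
      mul_le_mul hη1 haH ha0 (by positivity)
    have h8 : lam / 2 * D ≤ lam / 2 * H := mul_le_mul_of_nonneg_left hDH (by positivity)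
    have h9 : V * T = V * C * S + V * M * η * a := by rw [hT]; ring
    linarith
end
end
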